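/- arXiv:2212.00838 — 9 statements merged into one kernel-verified Lean document; each statement's English description precedes it below -/
import Mathlib

section
/- Let S be a commutative ring, m ≥ 1, and R = S[x₁,…,x_m] the polynomial ring in m variables over S. Let A be a p×q matrix and B a q×r matrix whose entries are homogeneous polynomials of degree 1 in R. If A·B = 0 (as a matrix over R), then for all indices a, b ∈ {1,…,m} one has (∂A/∂x_a)·(∂B/∂x_b) + (∂A/∂x_b)·(∂B/∂x_a) = 0, where ∂M/∂x_c denotes the entrywise partial derivative of the matrix M with respect to x_c. -/
open MvPolynomial

/-- Let `S` be a commutative ring, `m ≥ 1`, and `R = S[x₁,…,x_m]`.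
If `A` is a `p×q` matrix and `B` a `q×r` matrix of linear forms (homogeneous of degree 1)
over `R` with `A * B = 0`, then for all variables `a b` we have
`(∂A/∂x_a)·(∂B/∂x_b) + (∂A/∂x_b)·(∂B/∂x_a) = 0`. -/
theorem stmt_0 {S : Type*} [CommRing S] {m p q r : ℕ} (hm : 1 ≤ m)
    (A : Matrix (Fin p) (Fin q) (MvPolynomial (Fin m) S))
    (B : Matrix (Fin q) (Fin r) (MvPolynomial (Fin m) S))
    (hA : ∀ i j, (A i j).IsHomogeneous 1)
    (hB : ∀ i j, (B i j).IsHomogeneous 1)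
    (hAB : A * B = 0) (a b : Fin m) :
    A.map (⇑(pderiv a)) * B.map (⇑(pderiv b))
      + A.map (⇑(pderiv b)) * B.map (⇑(pderiv a)) = 0 := by
  have key : ∀ (f : MvPolynomial (Fin m) S), f.IsHomogeneous 1 →
      pderiv a (pderiv b f) = 0 := by
    intro f hf
    have h : (pderiv b f).IsHomogeneous 0 := hf.pderiv
    rw [← totalDegree_zero_iff_isHomogeneous, totalDegree_eq_zero_iff_eq_C] at h
    rw [h, pderiv_C]
  ext1 i k
  have h : ∑ j, A i j * B j k = 0 := by
    have := congrFun (congrFun hAB i) k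
    rwa [Matrix.mul_apply] at this
  have h2 := congrArg (fun f => pderiv a (pderiv b f)) h
  simp only [map_sum, map_zero, pderiv_mul, map_add] at h2
  simp only [Matrix.add_apply, Matrix.mul_apply, Matrix.map_apply, Matrix.zero_apply]
  rw [← Finset.sum_add_distrib, ← h2]
  refine Finset.sum_congr rfl fun j _ => ?_
  rw [key _ (hA i j), key _ (hB j k)]
  ring
end

section
/- Fix integers N ≥ 3, m ≥ 2, and indices a₁,…,a_N ∈ {1,…,m} together with an index k with 2 ≤ k ≤ N−1 such that a_k = m. Then the matrix product (∂d₁/∂x_{a₁})·(∂d₂/∂x_{a₂})⋯(∂d_N/∂x_{a_N}) has all blocks equal to zero except the block from the summand ℱ_{N−1} of the source of d_N to the summand ℱ₀ of the target of d₁, and that block equals (−1)^{k+1}·(∂φ₁/∂x_{a₁})⋯(∂φ_{k−1}/∂x_{a_{k−1}})·(∂φ_k/∂x_{a_{k+1}})⋯(∂φ_{N−1}/∂x_{a_N}). -/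
open MvPolynomial

/-- `fmdim f j` is the dimension of `ℱ_{j-1}` (zero for `j = 0`). -/
abbrev fmdim (f : ℕ → ℕ) : ℕ → ℕ
  | 0 => 0
  | j + 1 => f j

/-- The index type of `ℱ_j ⊕ 𝒢_j ⊕ ℱ_{j-1}`, the `j`-th module of the complex `ℋ`. -/
abbrev Tidx (f g : ℕ → ℕ) (j : ℕ) : Type :=
  Fin (f j) ⊕ Fin (g j) ⊕ Fin (fmdim f j)

section

variable {R : Type*} [CommRing R]

/-- `philow Φ j` is the matrix of `φ_j : ℱ_j → ℱ_{j-1}` (empty for `j = 0`), where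
`Φ j` is the matrix of `φ_{j+1} : ℱ_{j+1} → ℱ_j`. -/
def philow (f : ℕ → ℕ) (Φ : ∀ j, Matrix (Fin (f j)) (Fin (f (j + 1))) R) :
    ∀ j, Matrix (Fin (fmdim f j)) (Fin (f j)) R
  | 0 => Matrix.of fun r _ => r.elim0
  | j + 1 => Φ j

/-- The `3×3`-block matrix of `d_{j+1} : ℱ_{j+1} ⊕ 𝒢_{j+1} ⊕ ℱ_j → ℱ_j ⊕ 𝒢_j ⊕ ℱ_{j-1}`,
`d_i = (φ_i, α_i, −δ_i; 0, −ψ_i, β_{i−1}; 0, 0, φ_{i−1})`, where `Φ j, Ψ j, A j, Δ j`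
are the matrices of `φ_{j+1}, ψ_{j+1}, α_{j+1}, δ_{j+1}` and `B j` is the matrix of
`β_j`. -/
def Dmat (f g : ℕ → ℕ)
    (Φ : ∀ j, Matrix (Fin (f j)) (Fin (f (j + 1))) R)
    (Ψ : ∀ j, Matrix (Fin (g j)) (Fin (g (j + 1))) R)
    (A : ∀ j, Matrix (Fin (f j)) (Fin (g (j + 1))) R)
    (B : ∀ j, Matrix (Fin (g j)) (Fin (f j)) R)
    (Δ : ∀ j, Matrix (Fin (f j)) (Fin (f j)) R)
    (j : ℕ) : Matrix (Tidx f g j) (Tidx f g (j + 1)) R :=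
  Matrix.of fun row col =>
    match row, col with
    | Sum.inl r, Sum.inl c => Φ j r c
    | Sum.inl r, Sum.inr (Sum.inl c) => A j r c
    | Sum.inl r, Sum.inr (Sum.inr c) => -(Δ j r c)
    | Sum.inr (Sum.inl _), Sum.inl _ => 0
    | Sum.inr (Sum.inl r), Sum.inr (Sum.inl c) => -(Ψ j r c)
    | Sum.inr (Sum.inl r), Sum.inr (Sum.inr c) => B j r c
    | Sum.inr (Sum.inr _), Sum.inl _ => 0
    | Sum.inr (Sum.inr _), Sum.inr (Sum.inl _) => 0
    | Sum.inr (Sum.inr r), Sum.inr (Sum.inr c) => philow f Φ j r c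

/-- The partial product `M_0 ⬝ M_1 ⬝ ⋯ ⬝ M_{j-1}` of matrices
`M_j : Tidx f g j → Tidx f g (j+1)`. -/
def chainProd (f g : ℕ → ℕ) (M : ∀ j, Matrix (Tidx f g j) (Tidx f g (j + 1)) R) :
    ∀ j, Matrix (Tidx f g 0) (Tidx f g j) R
  | 0 => 1
  | j + 1 => chainProd f g M j * M j

/-- The partial product `M_0 ⬝ M_1 ⬝ ⋯ ⬝ M_{j-1}` of matrices
`M_j : Fin (f j) → Fin (f (j+1))`. -/
def phiProd (f : ℕ → ℕ) (M : ∀ j, Matrix (Fin (f j)) (Fin (f (j + 1))) R) :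
    ∀ j, Matrix (Fin (f 0)) (Fin (f j)) R
  | 0 => 1
  | j + 1 => phiProd f M j * M j

/-- The product `M_0 ⬝ M_1 ⬝ ⋯ ⬝ M_{j-2}`, with columns indexed by `Fin (fmdim f j)`. -/
def phiProdShift (f : ℕ → ℕ) (M : ∀ j, Matrix (Fin (f j)) (Fin (f (j + 1))) R) :
    ∀ j, Matrix (Fin (f 0)) (Fin (fmdim f j)) R
  | 0 => Matrix.of fun _ c => c.elim0
  | j + 1 => phiProd f M j

end

theorem pd_zero_aux {S : Type*} [CommRing S] {m : ℕ} (x : Fin m) (p : MvPolynomial (Fin m) S)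
    (h : degreeOf x p = 0) : pderiv x p = 0 := by
  apply pderiv_eq_zero_of_notMem_vars
  intro hx
  rw [mem_vars_iff_mem_support] at hx
  obtain ⟨d, hd, hxd⟩ := hx
  have := monomial_le_degreeOf x hd
  have h2 := Finsupp.mem_support_iff.mp hxd
  omega

theorem stage_one_aux {R : Type*} [CommRing R] (f g : ℕ → ℕ)
    (M : ∀ j, Matrix (Tidx f g j) (Tidx f g (j + 1)) R)
    (P : ∀ j, Matrix (Fin (f j)) (Fin (f (j + 1))) R) (K : ℕ)
    (h1 : ∀ j, j < K → ∀ r c, M j (Sum.inl r) (Sum.inl c) = P j r c)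
    (h2 : ∀ j, j < K → ∀ r c, M j (Sum.inr r) (Sum.inl c) = 0) :
    ∀ j, j ≤ K → (∀ r c, chainProd f g M j (Sum.inl r) (Sum.inl c) = phiProd f P j r c) ∧
      (∀ r c, chainProd f g M j (Sum.inr r) (Sum.inl c) = 0) := by
  intro j
  induction j with
  | zero =>
    intro _
    constructor
    · intro r c
      simp [chainProd, phiProd, Matrix.one_apply]
    · intro r c
      simp [chainProd, Matrix.one_apply]
  | succ j ih =>
    intro hj
    obtain ⟨i1, i2⟩ := ih (by omega)
    constructor
    · intro r c
      rw [chainProd, phiProd, Matrix.mul_apply, Matrix.mul_apply, Fintype.sum_sum_type]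
      simp only [h1 j (by omega), h2 j (by omega), i1, mul_zero, Finset.sum_const_zero, add_zero]
    · intro r c
      rw [chainProd, Matrix.mul_apply, Fintype.sum_sum_type]
      simp only [h2 j (by omega), i2, mul_zero, zero_mul, Finset.sum_const_zero, add_zero]

/-- The target matrix. -/
def tgtAux {R : Type*} [CommRing R] (f g : ℕ → ℕ) (j : ℕ) (e : R)
    (Q : Matrix (Fin (f 0)) (Fin (fmdim f j)) R) : Matrix (Tidx f g 0) (Tidx f g j) R :=
  Matrix.of fun row col =>
    Sum.elim (fun r => Sum.elim (fun _ => 0) (Sum.elim (fun _ => 0) (fun c => e * Q r c)) col)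
      (fun _ => 0) row

theorem stage_two_aux {R : Type*} [CommRing R] (f g : ℕ → ℕ)
    (M : ∀ j, Matrix (Tidx f g j) (Tidx f g (j + 1)) R)
    (P : ∀ j, Matrix (Fin (f j)) (Fin (f (j + 1))) R) (K : ℕ) (e : R)
    (h1 : ∀ j, j < K → ∀ r c, M j (Sum.inl r) (Sum.inl c) = P j r c)
    (h2 : ∀ j, j < K → ∀ r c, M j (Sum.inr r) (Sum.inl c) = 0)
    (hE : M K = Matrix.of fun row col =>
      Sum.elim (fun r => Sum.elim (fun _ => 0) (Sum.elim (fun _ => 0) (fun c => 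
        e * (1 : Matrix (Fin (f K)) (Fin (f K)) R) r c)) col)
      (fun _ => 0) row)
    (h3 : ∀ j r c, M j (Sum.inr (Sum.inr r)) (Sum.inl c) = 0)
    (h4 : ∀ j r c, M j (Sum.inr (Sum.inr r)) (Sum.inr (Sum.inl c)) = 0)
    (h5 : ∀ j, K ≤ j → ∀ (r : Fin (f j)) (c : Fin (f (j + 1))),
      M (j + 1) (Sum.inr (Sum.inr r)) (Sum.inr (Sum.inr c)) = P j r c) :
    ∀ i, chainProd f g M (K + 1 + i) = tgtAux f g (K + 1 + i) e (phiProdShift f P (K + 1 + i)) := by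
  intro i
  induction i with
  | zero =>
    obtain ⟨i1, i2⟩ := stage_one_aux f g M P K h1 h2 K le_rfl
    ext row col
    change (chainProd f g M K * M K) row col = tgtAux f g (K + 1) e (phiProd f P K) row col
    rw [hE, Matrix.mul_apply, Fintype.sum_sum_type]
    rcases row with r | r <;> rcases col with c | c | c <;>
      simp [i1, i2, tgtAux, Matrix.one_apply, mul_comm]
  | succ i ih =>
    have hK : K + 1 + i = (K + i) + 1 := by omega
    have hK' : K + 1 + (i + 1) = (K + i) + 1 + 1 := by omega
    rw [hK'] 
    rw [hK] at ih
    generalize hj : K + i = j at *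
    ext row col
    change (chainProd f g M (j + 1) * M (j + 1)) row col
      = tgtAux f g (j + 1 + 1) e (phiProd f P j * P j) row col
    rw [ih, Matrix.mul_apply, Fintype.sum_sum_type, Fintype.sum_sum_type]
    rcases row with r | r <;> rcases col with c | c | c <;>
      simp [tgtAux, h3, h4, h5 j (by omega), Matrix.mul_apply, Finset.mul_sum, mul_assoc,
        phiProdShift]

/-- Fix `N ≥ 3`, `m ≥ 2`, indices `a₁,…,a_N ∈ {1,…,m}` (here `a i` is
the variable index `a_i` for `1 ≤ i ≤ N`) and `2 ≤ k ≤ N−1` with `a_k = x_m` (the last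
variable `xm`).  Let `φ_i, ψ_i, α_i, β_i, γ_i` be matrices over `R = S[x₁,…,x_m]` whose
entries do not involve `x_m` (here `Φ j, Ψ j, A j, Γ j` are the matrices of
`φ_{j+1}, ψ_{j+1}, α_{j+1}, γ_{j+1}` and `B j` that of `β_j`), representing maps of a
complex of length `N` with `ℱ` indexed by `0,…,N−1` and `𝒢` by `0,…,N`, and set
`δ_i := γ_i + (−1)^i·x_m·Id` and let `d_i` be the `3×3`-block matrix
`(φ_i, α_i, −δ_i; 0, −ψ_i, β_{i−1}; 0, 0, φ_{i−1})`.

Then `(∂d₁/∂x_{a₁})⋯(∂d_N/∂x_{a_N})` has all blocks zero except the block from the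
summand `ℱ_{N−1}` of the source of `d_N` to the summand `ℱ₀` of the target of `d₁`,
which equals
`(−1)^{k+1}·(∂φ₁/∂x_{a₁})⋯(∂φ_{k−1}/∂x_{a_{k−1}})·(∂φ_k/∂x_{a_{k+1}})⋯(∂φ_{N−1}/∂x_{a_N})`. -/
theorem stmt_1 {S : Type*} [CommRing S] (m : ℕ) (hm : 2 ≤ m) (N : ℕ) (hN : 3 ≤ N)
    (xm : Fin m) (hxm : (xm : ℕ) = m - 1)
    (f g : ℕ → ℕ)
    (hf : ∀ j, N ≤ j → f j = 0) (hg : ∀ j, N < j → g j = 0)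
    (Φ : ∀ j, Matrix (Fin (f j)) (Fin (f (j + 1))) (MvPolynomial (Fin m) S))
    (Ψ : ∀ j, Matrix (Fin (g j)) (Fin (g (j + 1))) (MvPolynomial (Fin m) S))
    (A : ∀ j, Matrix (Fin (f j)) (Fin (g (j + 1))) (MvPolynomial (Fin m) S))
    (B : ∀ j, Matrix (Fin (g j)) (Fin (f j)) (MvPolynomial (Fin m) S))
    (Γ : ∀ j, Matrix (Fin (f j)) (Fin (f j)) (MvPolynomial (Fin m) S))
    (hΦ : ∀ j r c, degreeOf xm (Φ j r c) = 0)
    (hΨ : ∀ j r c, degreeOf xm (Ψ j r c) = 0)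
    (hA : ∀ j r c, degreeOf xm (A j r c) = 0)
    (hB : ∀ j r c, degreeOf xm (B j r c) = 0)
    (hΓ : ∀ j r c, degreeOf xm (Γ j r c) = 0)
    (a : ℕ → Fin m) (k : ℕ) (hk2 : 2 ≤ k) (hkN : k ≤ N - 1) (hak : a k = xm) :
    chainProd f g
      (fun j =>
        (Dmat f g Φ Ψ A B
            (fun j => Γ j +
              ((-1 : MvPolynomial (Fin m) S) ^ (j + 1) * X xm) •
                (1 : Matrix (Fin (f j)) (Fin (f j)) (MvPolynomial (Fin m) S)))
            j).map (⇑(pderiv (a (j + 1)))))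
      N
    = Matrix.of fun row col =>
        match row, col with
        | Sum.inl r, Sum.inr (Sum.inr c) =>
            (-1 : MvPolynomial (Fin m) S) ^ (k + 1) *
              phiProdShift f
                (fun j => (Φ j).map (⇑(pderiv (if j + 1 < k then a (j + 1) else a (j + 2)))))
                N r c
        | _, _ => 0 := by
  obtain ⟨K, rfl⟩ : ∃ K, k = K + 1 := ⟨k - 1, by omega⟩
  obtain ⟨i, rfl⟩ : ∃ i, N = K + 1 + i := ⟨N - (K + 1), by omega⟩
  refine (stage_two_aux f g _
    (fun j => (Φ j).map (⇑(pderiv (if j + 1 < K + 1 then a (j + 1) else a (j + 2))))) K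
    ((-1) ^ (K + 1 + 1)) ?_ ?_ ?_ ?_ ?_ ?_ i).trans ?_
  · intro j hj r c
    simp [Dmat, hj]
  · intro j hj r c
    rcases r with r | r <;> simp [Dmat]
  · have hX : ∀ n : ℕ, pderiv xm ((-1 : MvPolynomial (Fin m) S) ^ n * X xm) = (-1) ^ n := by
      intro n
      rcases neg_one_pow_eq_or (MvPolynomial (Fin m) S) n with h | h <;> simp [h]
    have hlow : ∀ j r c, pderiv xm (philow f Φ j r c) = 0 := by
      intro j r c
      rcases j with _ | j
      · exact r.elim0
      · exact pd_zero_aux _ _ (hΦ j r c)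
    ext1 row col
    rw [Matrix.map_apply, hak]
    rcases row with r | r | r <;> rcases col with c | c | c <;>
      simp only [Dmat, Matrix.of_apply, Sum.elim_inl, Sum.elim_inr, map_neg, map_zero, neg_zero, hlow,
        pd_zero_aux _ _ (hΦ _ _ _), pd_zero_aux _ _ (hΨ _ _ _), pd_zero_aux _ _ (hA _ _ _),
        pd_zero_aux _ _ (hB _ _ _)]
    rw [Matrix.add_apply, map_add, pd_zero_aux _ _ (hΓ _ _ _), Matrix.smul_apply, smul_eq_mul,
      Matrix.one_apply]
    split_ifs
    · rw [mul_one, hX]; ring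
    · simp
  · intro j r c
    simp [Dmat]
  · intro j r c
    simp [Dmat]
  · intro j hj r c
    have : ¬ j < K := by omega
    simp [Dmat, philow, this]
  · ext1 row col
    rcases row with r | r <;> rcases col with c | c | c <;> rfl
end

section
/- Given an unprojection datum (β, α, γ) on chain complexes F = (F_i, φ_i)_{0≤i≤n−2} and G = (G_i, ψ_i)_{0≤i≤n−1} of R-modules, the R-linear maps h_i : M(β)_i → F_{i−1} defined by h_i(g, f) = −α_i(g) + γ_i(f) satisfy h_{i−1} ∘ d_i = φ_{i−1} ∘ h_i for all i; that is, h is a chain map from the shifted mapping cone M(β)[1] to F. -/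
/-- Given an unprojection datum `(β, α, γ)` on chain complexes
`F = (F_i, φ_i)_{0≤i≤n−2}` and `G = (G_i, ψ_i)_{0≤i≤n−1}` of `R`-modules, the maps
`h_i : M(β)_i → F_{i−1}`, `h_i(g, f) = −α_i(g) + γ_i(f)` satisfy
`h_{i−1} ∘ d_i = φ_{i−1} ∘ h_i` for all `i`: `h` is a chain map `M(β)[1] → F`.

Indexing convention: `φ i : F (i+1) → F i` is the map `φ_{i+1}` of the paper (and
similarly `ψ i = ψ_{i+1}`, `α i = α_{i+1} : G_{i+1} → F_i`, `γ i = γ_{i+1} : F_i → F_i`);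
`β i = β_i`.  Out-of-range modules/maps (index `−1`) are zero and are not represented;
the instances of the conclusion involving them are trivially `0 = 0`. -/
theorem stmt_2 {R : Type*} [Ring R] {n : ℕ}
    (F G : ℕ → Type*)
    [∀ i, AddCommGroup (F i)] [∀ i, Module R (F i)]
    [∀ i, AddCommGroup (G i)] [∀ i, Module R (G i)]
    (φ : ∀ i, F (i + 1) →ₗ[R] F i) (ψ : ∀ i, G (i + 1) →ₗ[R] G i)
    (hφ : ∀ i, φ i ∘ₗ φ (i + 1) = 0) (hψ : ∀ i, ψ i ∘ₗ ψ (i + 1) = 0)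
    (hFbd : ∀ i, n - 2 < i → ∀ x : F i, x = 0)
    (hGbd : ∀ i, n - 1 < i → ∀ x : G i, x = 0)
    -- `β : F → G` is a chain map
    (β : ∀ i, F i →ₗ[R] G i)
    (hβ : ∀ i, ψ i ∘ₗ β (i + 1) = β i ∘ₗ φ i)
    -- `α : G → F` is a degree `−1` chain map
    (α : ∀ i, G (i + 1) →ₗ[R] F i)
    (hα : ∀ i, φ i ∘ₗ α (i + 1) = α i ∘ₗ ψ (i + 1))
    -- `γ` is a null homotopy for `α ∘ β` with `γ₁ = 0`
    (γ : ∀ i, F i →ₗ[R] F i)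
    (hγ0 : γ 0 = 0)
    (hγ : ∀ i, α i ∘ₗ β (i + 1) = φ i ∘ₗ γ (i + 1) + γ i ∘ₗ φ i) :
    -- `h i := h_{i+1} : M(β)_{i+1} = G_{i+1} × F_i → F_i`, `d i := d_{i+2}`;
    -- conclusion: `h_{i+1} ∘ d_{i+2} = φ_{i+1} ∘ h_{i+2}` for all `i`.
    ∀ i,
      (γ i ∘ₗ LinearMap.snd R (G (i + 1)) (F i)
          - α i ∘ₗ LinearMap.fst R (G (i + 1)) (F i)) ∘ₗ
        LinearMap.prod
          (ψ (i + 1) ∘ₗ LinearMap.fst R (G (i + 2)) (F (i + 1))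
            - β (i + 1) ∘ₗ LinearMap.snd R (G (i + 2)) (F (i + 1)))
          (-(φ i) ∘ₗ LinearMap.snd R (G (i + 2)) (F (i + 1)))
      = φ i ∘ₗ
        (γ (i + 1) ∘ₗ LinearMap.snd R (G (i + 2)) (F (i + 1))
          - α (i + 1) ∘ₗ LinearMap.fst R (G (i + 2)) (F (i + 1))) := by
  intro i
  refine LinearMap.ext ?_
  rintro ⟨g, f⟩
  have h1 : φ i (α (i + 1) g) = α i (ψ (i + 1) g) := LinearMap.congr_fun (hα i) g
  have h2 : α i (β (i + 1) f) = φ i (γ (i + 1) f) + γ i (φ i f) :=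
    LinearMap.congr_fun (hγ i) f
  change γ i (-(φ i f)) - α i (ψ (i + 1) g - β (i + 1) f)
    = φ i (γ (i + 1) f - α (i + 1) g)
  rw [map_neg, map_sub, map_sub, h1, h2]
  abel
end

section
/- Let R be a commutative ring and let F = (F_i, φ_i) be a bounded nonnegatively graded chain complex of finitely generated free R-modules with F₀ = R and H_i(F) = 0 for all i ≥ 1. Then F admits a DGCA structure: there exists a family of R-bilinear multiplication maps F_i × F_j → F_{i+j} which is graded commutative, satisfies the Leibniz rule with respect to the differentials φ, has x·x = 0 for x in odd degree, and for which the multiplication F₀ × F_i → F_i is the R-scalar multiplication. -/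
universe u

/-- `Cfam R Cpos` is a nonnegatively graded family of modules with degree-0 part
equal to `R` and degree-`(i+1)` part `Cpos i`. -/
abbrev Cfam (R : Type u) (Cpos : ℕ → Type u) : ℕ → Type u
  | 0 => R
  | i + 1 => Cpos i

instance Cfam.addCommGroup (R : Type u) [CommRing R] (Cpos : ℕ → Type u)
    [∀ i, AddCommGroup (Cpos i)] : ∀ i, AddCommGroup (Cfam R Cpos i)
  | 0 => inferInstanceAs (AddCommGroup R)
  | i + 1 => inferInstanceAs (AddCommGroup (Cpos i))

instance Cfam.module (R : Type u) [CommRing R] (Cpos : ℕ → Type u)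
    [∀ i, AddCommGroup (Cpos i)] [∀ i, Module R (Cpos i)] :
    ∀ i, Module R (Cfam R Cpos i)
  | 0 => inferInstanceAs (Module R R)
  | i + 1 => inferInstanceAs (Module R (Cpos i))


namespace DG

theorem negpow_congr {a b : ℕ} (h : Even (a + b)) : (-1 : ℤ) ^ a = (-1) ^ b := by
  rw [Nat.even_add] at h
  rcases Nat.even_or_odd a with ha | ha
  · rw [ha.neg_one_pow, (h.1 ha).neg_one_pow]
  · have hb : Odd b := by
      rw [← Nat.not_even_iff_odd] at ha ⊢
      exact fun hb => ha (h.2 hb)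
    rw [ha.neg_one_pow, hb.neg_one_pow]

theorem lift_bilin {R : Type*} [CommRing R] {M P N Q : Type*} [AddCommGroup M] [AddCommGroup P]
    [AddCommGroup N] [AddCommGroup Q] [Module R M] [Module R P] [Module R N] [Module R Q]
    (hM : Module.Free R M) (hP : Module.Free R P) (δ : N →ₗ[R] Q) (z : M →ₗ[R] P →ₗ[R] Q)
    (hz : ∀ x y, ∃ w, δ w = z x y) : ∃ f : M →ₗ[R] P →ₗ[R] N, ∀ x y, δ (f x y) = z x y := by
  let b := Module.Free.chooseBasis R M
  let c := Module.Free.chooseBasis R P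
  choose w hw using hz
  let f : M →ₗ[R] P →ₗ[R] N := b.constr R (fun a => c.constr R (fun a' => w (b a) (c a')))
  refine ⟨f, ?_⟩
  have : f.compr₂ δ = z := by
    refine b.ext fun a => c.ext fun a' => ?_
    simp [f, hw]
  intro x y
  rw [← this]; rfl

theorem lift_diag {R : Type*} [CommRing R] {M N Q : Type*} [AddCommGroup M]
    [AddCommGroup N] [AddCommGroup Q] [Module R M] [Module R N] [Module R Q]
    (hM : Module.Free R M) (δ : N →ₗ[R] Q) (z : M →ₗ[R] M →ₗ[R] Q)
    (hz : ∀ x y, ∃ w, δ w = z x y) (n : ℕ)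
    (hsym : ∀ x y, z x y = ((-1 : ℤ) ^ n) • z y x) (halt : Odd n → ∀ x, z x x = 0) :
    ∃ f : M →ₗ[R] M →ₗ[R] N, (∀ x y, δ (f x y) = z x y) ∧
      (∀ x y, f x y = ((-1 : ℤ) ^ n) • f y x) ∧ (Odd n → ∀ x, f x x = 0) := by
  classical
  let b := Module.Free.chooseBasis R M
  let _ : LinearOrder (Module.Free.ChooseBasisIndex R M) := linearOrderOfSTO WellOrderingRel
  choose w hw using hz
  let g : Module.Free.ChooseBasisIndex R M → Module.Free.ChooseBasisIndex R M → N := fun a a' =>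
    if a < a' then w (b a) (b a') else if a' < a then ((-1 : ℤ) ^ n) • w (b a') (b a)
      else if Odd n then 0 else w (b a) (b a)
  have hee : ((-1 : ℤ) ^ n) * ((-1 : ℤ) ^ n) = 1 := by
    rw [← pow_add]; exact Even.neg_one_pow ⟨n, rfl⟩
  have hgd : ∀ a a', δ (g a a') = z (b a) (b a') := by
    intro a a'
    rcases lt_trichotomy a a' with h | h | h
    · simp [g, h, hw]
    · subst h
      by_cases ho : Odd n
      · simp [g, ho, halt]
      · simp [g, ho, hw]
    · simp only [g, h, h.not_gt, if_true, if_false]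
      rw [map_zsmul, hw, ← hsym]
  have hgs : ∀ a a', g a a' = ((-1 : ℤ) ^ n) • g a' a := by
    intro a a'
    rcases lt_trichotomy a a' with h | h | h
    · simp only [g, h, h.not_gt, if_true, if_false]
      rw [smul_smul, hee, one_smul]
    · subst h
      by_cases ho : Odd n
      · simp [g, ho]
      · simp [g, ho, (Nat.not_odd_iff_even.1 ho).neg_one_pow]
    · simp only [g, h, h.not_gt, if_true, if_false]
  let f : M →ₗ[R] M →ₗ[R] N := b.constr R (fun a => b.constr R (fun a' => g a a'))
  have hf : ∀ a a', f (b a) (b a') = g a a' := by intro a a'; simp [f]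
  have h1 : f.compr₂ δ = z := by
    refine b.ext fun a => b.ext fun a' => ?_
    simp [hf, hgd]
  have h2 : f = ((-1 : ℤ) ^ n) • f.flip := by
    refine b.ext fun a => b.ext fun a' => ?_
    rw [LinearMap.smul_apply, LinearMap.smul_apply, LinearMap.flip_apply, hf, hf, hgs]
  have h3 : ∀ x y, f x y = ((-1 : ℤ) ^ n) • f y x := by
    intro x y
    have := LinearMap.congr_fun (LinearMap.congr_fun h2 x) y
    rwa [LinearMap.smul_apply, LinearMap.smul_apply, LinearMap.flip_apply] at this
  refine ⟨f, fun x y => by rw [← h1]; rfl, h3, ?_⟩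
  intro ho x
  have hx : x ∈ Submodule.span R (Set.range b) := by rw [b.span_eq]; trivial
  induction hx using Submodule.span_induction with
  | mem x h =>
    obtain ⟨a, rfl⟩ := h
    rw [hf]; simp [g, ho]
  | zero => simp
  | add x y _ _ hx hy =>
    have := h3 x y
    rw [ho.neg_one_pow, neg_one_smul] at this
    simp [hx, hy, this]
  | smul c x _ hx => simp [hx]

section
variable {R : Type u} [CommRing R] (C : ℕ → Type u) [∀ i, AddCommGroup (C i)]
  [∀ i, Module R (C i)] (s : C 0 →ₗ[R] R) (δ : ∀ i, C (i + 1) →ₗ[R] C i)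

/-- Degree `k` part of a multiplication. -/
structure Level (k : ℕ) where
  m : ∀ i j, i + j = k → C i →ₗ[R] C j →ₗ[R] C k
  unit : ∀ (h : 0 + k = k) (x : C 0) (y : C k), m 0 k h x y = s x • y
  comm : ∀ i j (h : i + j = k) (h' : j + i = k) (x : C i) (y : C j),
    m i j h x y = ((-1 : ℤ) ^ (i * j)) • m j i h' y x
  alt : ∀ i (h : i + i = k), Odd i → ∀ x : C i, m i i h x x = 0

variable {C s}

/-- Right hand side of the Leibniz rule. -/
noncomputable def Level.z {k : ℕ} (L : Level C s k) (i j : ℕ) (h : i + j + 1 = k) :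
    C (i + 1) →ₗ[R] C (j + 1) →ₗ[R] C k :=
  (L.m i (j + 1) (by omega)).comp (δ i) +
    ((-1 : ℤ) ^ (i + 1)) • (L.m (i + 1) j (by omega)).compl₂ (δ j)

theorem Level.z_apply {k : ℕ} (L : Level C s k) (i j : ℕ) (h : i + j + 1 = k)
    (x : C (i + 1)) (y : C (j + 1)) : L.z δ i j h x y = L.m i (j + 1) (by omega) (δ i x) y +
    ((-1 : ℤ) ^ (i + 1)) • L.m (i + 1) j (by omega) x (δ j y) := by
  simp only [Level.z, LinearMap.add_apply, LinearMap.smul_apply, LinearMap.comp_apply,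
    LinearMap.compl₂_apply]

theorem Level.z_comm {k : ℕ} (L : Level C s k) (i j : ℕ) (h : i + j + 1 = k) (h' : j + i + 1 = k)
    (x : C (i + 1)) (y : C (j + 1)) :
    L.z δ i j h x y = ((-1 : ℤ) ^ ((i + 1) * (j + 1))) • L.z δ j i h' y x := by
  rw [L.z_apply, L.z_apply, L.comm j (i + 1) _ (by omega), L.comm (j + 1) i _ (by omega),
    smul_add, smul_smul, smul_smul, smul_smul, ← pow_add, ← pow_add, ← pow_add, add_comm]
  congr 1
  · rw [negpow_congr (b := (i + 1) * (j + 1) + j * (i + 1))]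
    exact ⟨(i + 1) * (j + 1), by ring⟩
  · rw [Even.neg_one_pow, one_smul]
    exact ⟨(i + 1) * (j + 1), by ring⟩

theorem Level.z_alt {k : ℕ} (L : Level C s k) (i : ℕ) (h : i + i + 1 = k) (ho : Odd (i + 1))
    (x : C (i + 1)) : L.z δ i i h x x = 0 := by
  rw [L.z_apply, L.comm (i + 1) i _ (by omega), ho.neg_one_pow, Even.neg_one_pow]
  · simp
  · rw [mul_comm]; exact Nat.even_mul_succ_self i

theorem Level.unit' {k : ℕ} (L : Level C s k) (h : k + 0 = k) (x : C k) (y : C 0) :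
    L.m k 0 h x y = s y • x := by
  rw [L.comm k 0 h (by omega), L.unit]; simp

/-- The Leibniz right hand sides can be lifted. -/
def Good {k : ℕ} (L : Level C s k) : Prop :=
  ∀ i j h x y, ∃ w, δ k w = L.z δ i j h x y

/-- Leibniz rule between consecutive levels. -/
def Leib {k : ℕ} (L : Level C s k) (L' : Level C s (k + 1)) : Prop :=
  ∀ i j (h : i + 1 + (j + 1) = k + 1) x y,
    δ k (L'.m (i + 1) (j + 1) h x y) = L.z δ i j (by omega) x y

theorem good_of_leib (hdd : ∀ i x, δ i (δ (i + 1) x) = 0)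
    (hex : ∀ i x, δ i x = 0 → ∃ y, δ (i + 1) y = x) {k : ℕ} {L : Level C s k}
    {L' : Level C s (k + 1)} (hL : Leib δ L L') : Good δ L' := by
  have A : ∀ i j (h : i + (j + 1) = k + 1) (x : C (i + 1)) (y : C (j + 1)),
      δ k (L'.m i (j + 1) h (δ i x) y) = ((-1 : ℤ) ^ i) • L.m i j (by omega) (δ i x) (δ j y) := by
    intro i j h x y
    cases i with
    | zero =>
      obtain rfl : j = k := by omega
      rw [L'.unit, L.unit]; simp
    | succ i => rw [hL, L.z_apply, hdd]; simp
  have B : ∀ i j (h : i + 1 + j = k + 1) (x : C (i + 1)) (y : C (j + 1)),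
      δ k (L'.m (i + 1) j h x (δ j y)) = L.m i j (by omega) (δ i x) (δ j y) := by
    intro i j h x y
    cases j with
    | zero =>
      obtain rfl : i = k := by omega
      rw [L'.unit', L.unit']; simp
    | succ i => rw [hL, L.z_apply, hdd]; simp
  intro i j h x y
  apply hex
  rw [L'.z_apply, map_add, map_zsmul, A, B, ← add_smul, pow_succ]
  simp

/-- Gluing chosen bilinear maps. -/
noncomputable def glue (s : C 0 →ₗ[R] R) (k : ℕ)
    (f : ∀ i j, i + j + 1 = k → C (i + 1) →ₗ[R] C (j + 1) →ₗ[R] C (k + 1)) :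
    ∀ i j, i + j = k + 1 → C i →ₗ[R] C j →ₗ[R] C (k + 1)
  | 0, j, h => (by obtain rfl : j = k + 1 := by omega
                   exact (LinearMap.lsmul R (C (k + 1))).comp s)
  | i + 1, 0, h => (by obtain rfl : i = k := by omega
                       exact ((LinearMap.lsmul R (C (i + 1))).comp s).flip)
  | i + 1, j + 1, h => if i ≤ j then f i j (by omega) else
      ((-1 : ℤ) ^ ((i + 1) * (j + 1))) • (f j i (by omega)).flip

theorem exists_next (hfree : ∀ i, Module.Free R (C i)) {k : ℕ} (L : Level C s k)
    (hL : Good δ L) : ∃ L' : Level C s (k + 1), Leib δ L L' := by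
  have key : ∀ i j (h : i + j + 1 = k), ∃ f : C (i + 1) →ₗ[R] C (j + 1) →ₗ[R] C (k + 1),
      (∀ x y, δ k (f x y) = L.z δ i j h x y) ∧ ∀ e : i = j,
      (∀ x y, f x y = ((-1 : ℤ) ^ ((i + 1) * (j + 1))) • f (e ▸ y) (e ▸ x)) ∧
        (Odd (i + 1) → ∀ x, f x (e ▸ x) = 0) := by
    intro i j h
    by_cases e : i = j
    · subst e
      obtain ⟨f, h1, h2, h3⟩ := lift_diag (hfree (i + 1)) (δ k) (L.z δ i i h) (hL i i h)
        ((i + 1) * (i + 1)) (L.z_comm δ i i h h)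
        (fun ho => L.z_alt δ i h (Nat.odd_mul.1 ho).1)
      exact ⟨f, h1, fun _ => ⟨h2, fun ho => h3 (ho.mul ho)⟩⟩
    · obtain ⟨f, h1⟩ := lift_bilin (hfree (i + 1)) (hfree (j + 1)) (δ k) (L.z δ i j h) (hL i j h)
      exact ⟨f, h1, fun e' => (e e').elim⟩
  choose f hf1 hf2 using key
  have hee : ∀ n : ℕ, ((-1 : ℤ) ^ n) * ((-1 : ℤ) ^ n) = 1 := fun n => by
    rw [← pow_add]; exact Even.neg_one_pow ⟨n, rfl⟩
  have gle : ∀ i j (h : i + 1 + (j + 1) = k + 1) x y, i ≤ j →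
      glue s k f (i + 1) (j + 1) h x y = f i j (by omega) x y := by
    intro i j h x y hij
    simp [glue, hij]
  have ggt : ∀ i j (h : i + 1 + (j + 1) = k + 1) x y, ¬ i ≤ j →
      glue s k f (i + 1) (j + 1) h x y
        = ((-1 : ℤ) ^ ((i + 1) * (j + 1))) • f j i (by omega) y x := by
    intro i j h x y hij
    simp only [glue, hij, if_false, LinearMap.smul_apply, LinearMap.flip_apply]
  have g0 : ∀ (h : 0 + (k + 1) = k + 1) x y, glue s k f 0 (k + 1) h x y = s x • y := by
    intro h x y
    simp [glue]
  have g0' : ∀ (h : k + 1 + 0 = k + 1) x y, glue s k f (k + 1) 0 h x y = s y • x := by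
    intro h x y
    simp [glue]
  refine ⟨⟨glue s k f, g0, ?_, ?_⟩, ?_⟩
  · intro i j h h' x y
    rcases i with _ | i
    · obtain rfl : j = k + 1 := by omega
      rw [g0, g0']; simp
    rcases j with _ | j
    · obtain rfl : i = k := by omega
      rw [g0, g0']; simp
    rcases lt_trichotomy i j with hij | hij | hij
    · rw [gle _ _ _ _ _ hij.le, ggt _ _ _ _ _ (by omega), smul_smul, mul_comm (j + 1), hee,
        one_smul]
    · subst hij
      rw [gle _ _ _ _ _ le_rfl, gle _ _ _ _ _ le_rfl]
      exact (hf2 i i _ rfl).1 x y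
    · rw [ggt _ _ _ _ _ (by omega), gle _ _ _ _ _ hij.le]
  · intro i h ho x
    rcases i with _ | i
    · simp at ho
    · rw [gle _ _ _ _ _ le_rfl]
      exact (hf2 i i _ rfl).2 ho x
  · intro i j h x y
    show δ k (glue s k f (i + 1) (j + 1) h x y) = _
    by_cases hij : i ≤ j
    · rw [gle _ _ _ _ _ hij, hf1]
    · rw [ggt _ _ _ _ _ hij, map_zsmul, hf1, ← L.z_comm]

theorem exists_mul (hs : ∀ x y : C 0, s x • y = s y • x) (hfree : ∀ i, Module.Free R (C i))
    (hdd : ∀ i x, δ i (δ (i + 1) x) = 0)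
    (hex : ∀ i x, δ i x = 0 → ∃ y, δ (i + 1) y = x) :
    ∃ L : ∀ k, Level C s k, ∀ k, Leib δ (L k) (L (k + 1)) := by
  let L0 : Level C s 0 :=
    { m := fun i j h => (by
        obtain rfl : i = 0 := by omega
        obtain rfl : j = 0 := by omega
        exact (LinearMap.lsmul R (C 0)).comp s)
      unit := fun h x y => by simp
      comm := fun i j h h' x y => by
        obtain rfl : i = 0 := by omega
        obtain rfl : j = 0 := by omega
        simp [hs x y]
      alt := fun i h ho x => by
        obtain rfl : i = 0 := by omega
        simp at ho }
  have G0 : Good δ L0 := fun i j h => by omega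
  have step : ∀ k (L : {L : Level C s k // Good δ L}),
      ∃ L' : {L : Level C s (k + 1) // Good δ L}, Leib δ L.1 L'.1 := by
    rintro k ⟨L, hL⟩
    obtain ⟨L', h⟩ := exists_next δ hfree L hL
    exact ⟨⟨L', good_of_leib δ hdd hex h⟩, h⟩
  choose nx hnx using step
  let S : ∀ k, {L : Level C s k // Good δ L} := fun k => Nat.rec ⟨L0, G0⟩ nx k
  exact ⟨fun k => (S k).1, fun k => hnx k (S k)⟩

end

end DG

/-- Let `R` be a commutative ring and `F = (F_i, φ_i)` a bounded
nonnegatively graded chain complex of finitely generated free `R`-modules with `F₀ = R`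
and `H_i(F) = 0` for `i ≥ 1`.  Then `F` admits a DGCA structure: a family of `R`-bilinear
multiplications `F_i × F_j → F_{i+j}` which is graded commutative, satisfies the Leibniz
rule, has `x·x = 0` in odd degrees, and restricts to scalar multiplication on `F₀ × F_i`.

The differential is given in the form `d i : F i → F (i-1)` (truncated subtraction,
with `d 0 = 0` as the out-of-range convention); the multiplication carries its target
degree `k` together with a proof `i + j = k`, so that all degree bookkeeping is
by propositional equalities of indices. -/
theorem stmt_7 {R : Type u} [CommRing R] (Fpos : ℕ → Type u)
    [∀ i, AddCommGroup (Fpos i)] [∀ i, Module R (Fpos i)]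
    (d : ∀ i, Cfam R Fpos i →ₗ[R] Cfam R Fpos (i - 1))
    (hd0 : d 0 = 0)
    (hdd : ∀ i, d i ∘ₗ d (i + 1) = 0)
    (hfree : ∀ i, Module.Free R (Cfam R Fpos i))
    (hfin : ∀ i, Module.Finite R (Cfam R Fpos i))
    (N : ℕ) (hbd : ∀ i, N < i → ∀ x : Cfam R Fpos i, x = 0)
    (hex : ∀ i (x : Cfam R Fpos (i + 1)), d (i + 1) x = 0 →
      ∃ y : Cfam R Fpos (i + 2), d (i + 2) y = x) :
    ∃ μ : ∀ i j k, i + j = k → Cfam R Fpos i →ₗ[R] Cfam R Fpos j →ₗ[R] Cfam R Fpos k,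
      -- multiplication by `F₀ = R` is scalar multiplication
      (∀ i (r : R) (x : Cfam R Fpos i), μ 0 i i (Nat.zero_add i) r x = r • x) ∧
      -- graded commutativity
      (∀ i j k (hij : i + j = k) (hji : j + i = k) (x : Cfam R Fpos i)
        (y : Cfam R Fpos j), μ i j k hij x y = ((-1 : ℤ) ^ (i * j)) • μ j i k hji y x) ∧
      -- squares vanish in odd degrees
      (∀ i k (h : i + i = k), Odd i → ∀ x : Cfam R Fpos i, μ i i k h x x = 0) ∧
      -- Leibniz rule
      (∀ i j k (hij : i + j = k) (h₁ : (i - 1) + j = k - 1) (h₂ : i + (j - 1) = k - 1)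
        (x : Cfam R Fpos i) (y : Cfam R Fpos j),
        d k (μ i j k hij x y)
          = μ (i - 1) j (k - 1) h₁ (d i x) y
            + ((-1 : ℤ) ^ i) • μ i (j - 1) (k - 1) h₂ x (d j y)) := by
  obtain ⟨L, hL⟩ := DG.exists_mul (C := Cfam R Fpos) (s := (LinearMap.id : R →ₗ[R] R))
    (fun i => d (i + 1)) (fun x y => mul_comm (x : R) (y : R)) hfree
    (fun i x => LinearMap.congr_fun (hdd (i + 1)) x) hex
  refine ⟨fun i j k h => (L k).m i j h, fun i r x => (L i).unit _ r x,
    fun i j k hij hji x y => (L k).comm i j hij hji x y,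
    fun i k h ho x => (L k).alt i h ho x, ?_⟩
  intro i j k hij h₁ h₂ x y
  rcases i with _ | i
  · obtain rfl : j = 0 := by omega
    obtain rfl : k = 0 := by omega
    simp [hd0]
  rcases j with _ | j
  · omega
  rcases k with _ | k
  · omega
  have := hL k i j hij x y
  rw [DG.Level.z_apply] at this
  exact this
end

section
/- Let p be a prime, n ≥ 1, and let A be an invertible n×n matrix with entries in ℚ_p. Then there exists ε > 0 such that for every n×n matrix B with entries in ℚ_p satisfying ‖A_{ij} − B_{ij}‖_p < ε for all i, j, there exists a matrix U with entries in ℤ_p that is invertible over ℤ_p (i.e. det U is a unit of ℤ_p) such that A = U·B, where U is viewed as a matrix over ℚ_p via the inclusion ℤ_p ⊆ ℚ_p. -/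
/-- Let `p` be a prime and `A` an invertible `n×n` matrix over `ℚ_p`.
Then there is `ε > 0` such that any matrix `B` over `ℚ_p` with `‖A i j - B i j‖ < ε`
for all `i j` satisfies `A = U * B` for some matrix `U` over `ℤ_p` that is invertible
over `ℤ_p` (its determinant is a unit of `ℤ_p`). -/
theorem stmt_9 (p : ℕ) [Fact p.Prime] (n : ℕ) (hn : 1 ≤ n)
    (A : Matrix (Fin n) (Fin n) ℚ_[p]) (hA : IsUnit A) :
    ∃ ε > (0 : ℝ), ∀ B : Matrix (Fin n) (Fin n) ℚ_[p],
      (∀ i j, ‖A i j - B i j‖ < ε) →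
      ∃ U : Matrix (Fin n) (Fin n) ℤ_[p], IsUnit U.det ∧
        A = U.map (fun u => (u : ℚ_[p])) * B := by
  have hdet : IsUnit A.det := (Matrix.isUnit_iff_isUnit_det A).1 hA
  have hAA : A * A⁻¹ = 1 := Matrix.mul_nonsing_inv A hdet
  have hAA' : A⁻¹ * A = 1 := Matrix.nonsing_inv_mul A hdet
  let f : (Fin n → Fin n → ℚ_[p]) → Matrix (Fin n) (Fin n) ℚ_[p] := fun B => Matrix.of B * A⁻¹
  have hf : Continuous f := by
    have h0 : Continuous (fun B : Fin n → Fin n → ℚ_[p] => Matrix.of B) := continuous_id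
    exact h0.matrix_mul continuous_const
  have hfA : f A = 1 := hAA
  have h1 : ∀ᶠ B in nhds (show Fin n → Fin n → ℚ_[p] from A), ∀ i j, f B i j ∈ Metric.closedBall (0 : ℚ_[p]) 1 := by
    rw [Filter.eventually_all]; intro i
    rw [Filter.eventually_all]; intro j
    have hc : Continuous fun B => f B i j := hf.matrix_elem i j
    refine hc.continuousAt.eventually_mem
      ((IsUltrametricDist.isOpen_closedBall (0 : ℚ_[p]) one_ne_zero).mem_nhds ?_)
    change f A i j ∈ _
    rw [hfA, Matrix.one_apply]
    split_ifs <;> simp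
  have h2 : ∀ᶠ B in nhds (show Fin n → Fin n → ℚ_[p] from A), (f B).det ∈ Metric.sphere (0 : ℚ_[p]) 1 := by
    have hc : Continuous fun B => (f B).det := hf.matrix_det
    refine hc.continuousAt.eventually_mem
      ((IsUltrametricDist.isOpen_sphere (0 : ℚ_[p]) one_ne_zero).mem_nhds ?_)
    change (f A).det ∈ _
    rw [hfA]
    simp
  obtain ⟨ε, hε, H⟩ := Metric.eventually_nhds_iff.1 (h1.and h2)
  refine ⟨ε, hε, fun B hB => ?_⟩
  obtain ⟨hB1, hB2⟩ := @H B (by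
    refine (dist_pi_lt_iff hε).2 fun i => (dist_pi_lt_iff hε).2 fun j => ?_
    rw [dist_comm, dist_eq_norm]
    exact hB i j)
  let V : Matrix (Fin n) (Fin n) ℤ_[p] := fun i j => ⟨f B i j, by simpa using hB1 i j⟩
  have hV : V.map (PadicInt.Coe.ringHom (p := p)) = B * A⁻¹ := rfl
  have hVdet : IsUnit V.det := by
    rw [PadicInt.isUnit_iff, PadicInt.norm_def]
    have : ((V.det : ℤ_[p]) : ℚ_[p]) = (f B).det :=
      RingHom.map_det (PadicInt.Coe.ringHom (p := p)) V
    rw [this]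
    simpa using hB2
  refine ⟨V⁻¹, Matrix.isUnit_nonsing_inv_det V hVdet, ?_⟩
  change A = V⁻¹.map (PadicInt.Coe.ringHom (p := p)) * B
  have hBV : B = V.map (PadicInt.Coe.ringHom (p := p)) * A := by
    rw [hV, Matrix.mul_assoc, hAA', Matrix.mul_one]
  have key : V⁻¹.map (PadicInt.Coe.ringHom (p := p)) * V.map (PadicInt.Coe.ringHom (p := p)) = 1 := by
    rw [← Matrix.map_mul, Matrix.nonsing_inv_mul V hVdet]
    exact Matrix.map_one _ (map_zero _) (map_one _)
  calc A = (V⁻¹.map (PadicInt.Coe.ringHom (p := p)) * V.map (PadicInt.Coe.ringHom (p := p))) * A := by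
        rw [key, Matrix.one_mul]
    _ = V⁻¹.map (PadicInt.Coe.ringHom (p := p)) * B := by
        rw [Matrix.mul_assoc, ← hBV]
end

section
/- Let n ≥ 1 and let S be a finite set of primes. Suppose for each p ∈ S we are given a matrix A_p ∈ SL_n(ℤ_p) (an n×n matrix over the p-adic integers with determinant 1). Then for every ε > 0 there exists a matrix A ∈ SL_n(ℤ) (an integer n×n matrix with determinant 1) such that for every p ∈ S and all indices i, j one has ‖(A_{ij} : ℤ_p) − (A_p)_{ij}‖_p < ε, where the integer entries of A are regarded as elements of ℤ_p and ‖·‖_p is the p-adic norm. -/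
def VRel {R : Type*} [CommRing R] {n : ℕ} (v w : Fin n → R) : Prop :=
  ∃ U : Matrix (Fin n) (Fin n) ℤ, U.det = 1 ∧
    (U.map (Int.castRingHom R)).mulVec v = w

theorem VRel.refl {R : Type*} [CommRing R] {n : ℕ} (v : Fin n → R) : VRel v v :=
  ⟨1, Matrix.det_one, by simp⟩

theorem VRel.trans {R : Type*} [CommRing R] {n : ℕ} {u v w : Fin n → R}
    (h1 : VRel u v) (h2 : VRel v w) : VRel u w := by
  obtain ⟨U, hU, rfl⟩ := h1
  obtain ⟨V, hV, rfl⟩ := h2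
  refine ⟨V * U, by rw [Matrix.det_mul, hU, hV, one_mul], ?_⟩
  rw [Matrix.map_mul, Matrix.mulVec_mulVec]

theorem VRel.transvec {R : Type*} [CommRing R] {n : ℕ} (v w : Fin n → R) (i j : Fin n)
    (hij : i ≠ j) (c : ℤ) (hi : w i = v i + c * v j) (hk : ∀ k, k ≠ i → w k = v k) :
    VRel v w := by
  refine ⟨Matrix.transvection i j c, Matrix.det_transvection_of_ne i j hij c, ?_⟩
  have : (Matrix.transvection i j c).map (Int.castRingHom R)
      = Matrix.transvection i j (c : R) := by
    ext a b
    simp [Matrix.transvection, Matrix.single, Matrix.one_apply]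
  rw [this, Matrix.transvection, Matrix.add_mulVec, Matrix.one_mulVec]
  ext k
  by_cases h : k = i
  · subst h
    simp [hi, Matrix.single_mulVec]
  · simp [hk k h, Matrix.single_mulVec, h]

/-- change coordinates `i, j` from `(a,b)` to `(b,-a)` -/
theorem VRel.swap {R : Type*} [CommRing R] {n : ℕ} (v w : Fin n → R) (i j : Fin n)
    (hij : i ≠ j) (hi : w i = v j) (hj : w j = - v i)
    (hk : ∀ k, k ≠ i → k ≠ j → w k = v k) :
    VRel v w := by
  have hji := hij.symm
  set v1 := Function.update v i (v i + v j) with h1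
  set v2 := Function.update v1 j (- v i) with h2
  have a1 : VRel v v1 := VRel.transvec v v1 i j hij 1 (by simp [h1])
    (fun k hk => by simp [h1, hk])
  have a2 : VRel v1 v2 := VRel.transvec v1 v2 j i hji (-1) (by simp [h1, h2, hji])
    (fun k hk => by simp [h2, hk])
  have a3 : VRel v2 w := VRel.transvec v2 w i j hij 1 (by simp [h1, h2, hij, hi])
    (fun k hki => by
      by_cases hkj : k = j
      · subst hkj; simp [h2, hj]
      · simp [h1, h2, hkj, hki, hk])
  exact (a1.trans a2).trans a3

theorem VRel.euclid {R : Type*} [CommRing R] {n : ℕ} (i j : Fin n) (hij : i ≠ j) :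
    ∀ (m : ℕ) (v : Fin n → R) (a b : ℤ), b.natAbs = m → v i = a → v j = b →
      ∃ (w : Fin n → R), VRel v w ∧ w j = 0 ∧ ∀ k, k ≠ i → k ≠ j → w k = v k := by
  intro m
  induction m using Nat.strong_induction_on with
  | _ m ih =>
    intro v a b hb hva hvb
    by_cases hb0 : b = 0
    · exact ⟨v, VRel.refl v, by simp [hvb, hb0], fun _ _ _ => rfl⟩
    · set v1 := Function.update v i ((a % b : ℤ) : R) with h1
      set v2 := Function.update (Function.update v i (b : R)) j ((-(a % b) : ℤ) : R) with h2
      have hji := hij.symm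
      have a1 : VRel v v1 := VRel.transvec v v1 i j hij (-(a / b)) (by
          simp only [h1, Function.update_self, hva, hvb, Int.emod_def]
          push_cast; ring) (fun k hk => by simp [h1, hk])
      have a2 : VRel v1 v2 := VRel.swap v1 v2 i j hij (by simp [h1, h2, hij, hji, hvb])
        (by simp [h1, h2]) (fun k hk hk' => by simp [h1, h2, hk, hk'])
      have hlt : (-(a % b)).natAbs < m := by
        have := Int.emod_nonneg a hb0
        have := Int.emod_lt_abs a hb0
        rw [Int.abs_eq_natAbs] at this
        omega
      obtain ⟨w, hw, hwj, hwk⟩ := ih _ hlt v2 b (-(a % b)) rfl (by simp [h2, hij])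
        (by simp [h2])
      refine ⟨w, (a1.trans a2).trans hw, hwj, fun k hk hk' => ?_⟩
      rw [hwk k hk hk']
      simp [h2, hk, hk']

theorem VRel.clear {R : Type*} [CommRing R] (hR : Function.Surjective (Int.castRingHom R))
    {n : ℕ} (v : Fin (n+1) → R) (s : Finset (Fin (n+1))) (hs : 0 ∉ s) :
    ∃ w, VRel v w ∧ ∀ k ∈ s, w k = 0 := by
  induction s using Finset.induction_on with
  | empty => exact ⟨v, VRel.refl v, by simp⟩
  | insert j s hj ih =>
    simp only [Finset.mem_insert, not_or] at hs
    obtain ⟨w, hw, hw0⟩ := ih hs.2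
    obtain ⟨a, ha⟩ := hR (w 0)
    obtain ⟨b, hb⟩ := hR (w j)
    obtain ⟨w', hw', hj', hk'⟩ := VRel.euclid 0 j hs.1 _ w a b rfl ha.symm hb.symm
    refine ⟨w', hw.trans hw', fun k hk => ?_⟩
    rcases Finset.mem_insert.1 hk with rfl | hk
    · exact hj'
    · rw [hk' k (fun h => hs.2 (h ▸ hk)) (fun h => hj (h ▸ hk)), hw0 k hk]

theorem VRel.unit {R : Type*} [CommRing R] (hR : Function.Surjective (Int.castRingHom R))
    {n : ℕ} (v : Fin (n+2) → R) (hv : ∀ k, k ≠ 0 → v k = 0) (c : R) (hc : c * v 0 = 1) :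
    VRel v (Pi.single 0 1) := by
  obtain ⟨z, hz⟩ := hR c
  obtain ⟨y, hy⟩ := hR (1 - v 0)
  simp only [eq_intCast] at hz hy
  have h10 : (1 : Fin (n+2)) ≠ 0 := by simp
  have h01 : (0 : Fin (n+2)) ≠ 1 := by simp
  set v1 := Function.update v 1 1 with h1
  set v2 := Function.update v1 0 1 with h2
  have a1 : VRel v v1 := VRel.transvec v v1 1 0 h10 z (by simp [h1, hz, hc, hv])
    (fun k hk => by simp [h1, hk])
  have a2 : VRel v1 v2 := VRel.transvec v1 v2 0 1 h01 y (by simp [h1, h2, hy])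
    (fun k hk => by simp [h2, hk])
  have a3 : VRel v2 (Pi.single 0 1) := VRel.transvec v2 _ 1 0 h10 (-1) (by simp [h1, h2])
    (fun k hk => by
      by_cases h : k = 0
      · subst h; simp [h2]
      · simp [h1, h2, hk, h, hv])
  exact (a1.trans a2).trans a3

theorem det_col {R : Type*} [CommRing R] {n : ℕ} (B : Matrix (Fin (n+1)) (Fin (n+1)) R)
    (hB : ∀ k, k ≠ 0 → B k 0 = 0) :
    B.det = B 0 0 * (B.submatrix Fin.succ Fin.succ).det := by
  rw [Matrix.det_succ_column_zero, Fin.sum_univ_succ]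
  simp [hB]

theorem lift_of_mul {R : Type*} [CommRing R] {n : ℕ} (B : Matrix (Fin n) (Fin n) R)
    (U : Matrix (Fin n) (Fin n) ℤ) (hU : U.det = 1)
    (h : ∃ M : Matrix (Fin n) (Fin n) ℤ, M.det = 1 ∧
      M.map (Int.castRingHom R) = U.map (Int.castRingHom R) * B) :
    ∃ M : Matrix (Fin n) (Fin n) ℤ, M.det = 1 ∧ M.map (Int.castRingHom R) = B := by
  obtain ⟨M, hM, hMB⟩ := h
  have h1 : U.adjugate * U = 1 := by rw [Matrix.adjugate_mul, hU, one_smul]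
  have h2 : U.adjugate.det = 1 := by
    have := congrArg Matrix.det h1
    simpa [Matrix.det_mul, hU] using this
  refine ⟨U.adjugate * M, by rw [Matrix.det_mul, h2, hM, one_mul], ?_⟩
  rw [Matrix.map_mul, hMB, ← Matrix.mul_assoc, ← Matrix.map_mul, h1]
  simp

theorem det_map_eq {R : Type*} [CommRing R] {n : ℕ} (U : Matrix (Fin n) (Fin n) ℤ)
    (hU : U.det = 1) : (U.map (Int.castRingHom R)).det = 1 := by
  have := RingHom.map_det (Int.castRingHom R) U
  rw [hU, map_one] at this
  exact this.symm

theorem SL_lift {R : Type*} [CommRing R] (hR : Function.Surjective (Int.castRingHom R)) :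
    ∀ (n : ℕ) (B : Matrix (Fin n) (Fin n) R), B.det = 1 →
      ∃ M : Matrix (Fin n) (Fin n) ℤ, M.det = 1 ∧ M.map (Int.castRingHom R) = B
  | 0, B, _ => ⟨1, Matrix.det_one, Subsingleton.elim _ _⟩
  | 1, B, hB => ⟨1, Matrix.det_one, by
      rw [Matrix.det_fin_one] at hB
      ext i j
      fin_cases i; fin_cases j
      simp [hB]⟩
  | n+2, B, hB => by
    obtain ⟨w, ⟨U, hU, hUw⟩, hw⟩ := VRel.clear hR (fun i => B i 0)
      (Finset.univ.erase 0) (by simp)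
    apply lift_of_mul B U hU
    have hcol : ∀ k, (U.map (Int.castRingHom R) * B) k 0 = w k := by
      intro k; rw [← hUw]; rfl
    have hdet : (U.map (Int.castRingHom R) * B).det = 1 := by
      rw [Matrix.det_mul, det_map_eq U hU, hB, one_mul]
    generalize U.map (Int.castRingHom R) * B = C at hcol hdet
    have hC : ∀ k, k ≠ 0 → C k 0 = 0 := fun k hk => by
      rw [hcol]; exact hw k (by simp [hk])
    obtain ⟨V, hV, hVw⟩ := VRel.unit hR (fun k => C k 0) hC
      ((C.submatrix Fin.succ Fin.succ).det) (by rw [mul_comm, ← det_col C hC, hdet])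
    apply lift_of_mul C V hV
    have hcol2 : ∀ k, (V.map (Int.castRingHom R) * C) k 0 = (Pi.single 0 1 : Fin (n+2) → R) k := by
      intro k; rw [← hVw]; rfl
    have hdet2 : (V.map (Int.castRingHom R) * C).det = 1 := by
      rw [Matrix.det_mul, det_map_eq V hV, hdet, one_mul]
    generalize V.map (Int.castRingHom R) * C = D at hcol2 hdet2
    have hD : ∀ k, k ≠ 0 → D k 0 = 0 := fun k hk => by simp [hcol2, hk]
    have hD0 : D 0 0 = 1 := by simp [hcol2]
    rw [det_col D hD, hD0, one_mul] at hdet2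
    obtain ⟨M, hM, hMD⟩ := SL_lift hR (n+1) _ hdet2
    choose g hg using hR
    refine ⟨Matrix.of (Fin.cons (Fin.cons 1 (fun j => g (D 0 (Fin.succ j))))
      (fun i => Fin.cons 0 (M i))), ?_, ?_⟩
    · rw [det_col]
      · simp only [Matrix.of_apply, Fin.cons_zero, one_mul]
        rw [← hM]
        congr 1
      · intro k hk
        obtain ⟨k, rfl⟩ := Fin.exists_succ_eq.2 hk
        simp
    · ext i j
      refine Fin.cases ?_ (fun i => ?_) i <;> refine Fin.cases ?_ (fun j => ?_) j
      · simp [hD0]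
      · simpa using hg (D 0 j.succ)
      · simp [hD]
      · simpa using congrFun (congrFun hMD i) j

/-- Let `n ≥ 1` and let `S` be a finite set of primes. Given for each
`p ∈ S` a matrix `A p ∈ SL_n(ℤ_p)`, for every `ε > 0` there is `A ∈ SL_n(ℤ)` whose
entries are `p`-adically within `ε` of those of `A p`, for every `p ∈ S`. -/
theorem stmt_10 (n : ℕ) (hn : 1 ≤ n) (S : Finset ℕ) (hS : ∀ p ∈ S, p.Prime)
    (A : ∀ p, ∀ hp : p ∈ S,
      haveI : Fact p.Prime := ⟨hS p hp⟩
      Matrix (Fin n) (Fin n) ℤ_[p])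
    (hA : ∀ p, ∀ hp : p ∈ S,
      haveI : Fact p.Prime := ⟨hS p hp⟩
      (A p hp).det = 1)
    (ε : ℝ) (hε : 0 < ε) :
    ∃ M : Matrix (Fin n) (Fin n) ℤ, M.det = 1 ∧
      ∀ p, ∀ hp : p ∈ S,
        haveI : Fact p.Prime := ⟨hS p hp⟩
        ∀ i j, ‖((M i j : ℤ) : ℤ_[p]) - A p hp i j‖ < ε := by
  obtain ⟨k, hk⟩ := exists_pow_lt_of_lt_one hε (by norm_num : (1/2 : ℝ) < 1)
  have hcop : Set.Pairwise (S : Set ℕ) (Function.onFun Nat.Coprime (fun p => p ^ k)) := by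
    intro p hp q hq hpq
    exact Nat.Coprime.pow k k ((Nat.coprime_primes (hS p hp) (hS q hq)).2 hpq)
  have hcrt : ∀ i j, ∃ b : ℕ, ∀ p, ∀ hp : p ∈ S,
      haveI : Fact p.Prime := ⟨hS p hp⟩
      ((b : ℕ) : ZMod (p ^ k)) = PadicInt.toZModPow k (A p hp i j) := by
    intro i j
    let a : ℕ → ℕ := fun p => if hp : p ∈ S then
      haveI : Fact p.Prime := ⟨hS p hp⟩
      (PadicInt.toZModPow k (A p hp i j)).val else 0
    obtain ⟨b, hb⟩ := Nat.chineseRemainderOfFinset a (fun p => p ^ k) S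
      (fun p hp => pow_ne_zero _ (hS p hp).ne_zero) hcop
    refine ⟨b, fun p hp => ?_⟩
    haveI : Fact p.Prime := ⟨hS p hp⟩
    have := (ZMod.natCast_eq_natCast_iff _ _ _).2 (hb p hp)
    rw [this]
    simp [a, hp]
  choose b hb using hcrt
  set N := ∏ p ∈ S, p ^ k with hN
  let B : Matrix (Fin n) (Fin n) ℤ := Matrix.of fun i j => (b i j : ℤ)
  have hdvd : ∀ p ∈ S, ((p ^ k : ℕ) : ℤ) ∣ B.det - 1 := by
    intro p hp
    haveI : Fact p.Prime := ⟨hS p hp⟩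
    rw [← ZMod.intCast_zmod_eq_zero_iff_dvd]
    have h1 := RingHom.map_det (Int.castRingHom (ZMod (p ^ k))) B
    have h2 := RingHom.map_det (PadicInt.toZModPow (p := p) k) (A p hp)
    rw [hA p hp, map_one] at h2
    have h3 : (Int.castRingHom (ZMod (p ^ k))).mapMatrix B
        = (PadicInt.toZModPow (p := p) k).mapMatrix (A p hp) := by
      ext i j
      simpa [B] using hb i j p hp
    rw [h3, ← h2] at h1
    simp only [eq_intCast] at h1
    rw [Int.cast_sub, Int.cast_one, h1, sub_self]
  have hNd : (N : ℤ) ∣ B.det - 1 := by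
    rw [hN, Nat.cast_prod]
    refine Finset.prod_dvd_of_coprime ?_ hdvd
    intro p hp q hq hpq
    exact Nat.isCoprime_iff_coprime.2 (hcop hp hq hpq)
  have hdetN : (B.map (Int.castRingHom (ZMod N))).det = 1 := by
    have h1 := RingHom.map_det (Int.castRingHom (ZMod N)) B
    have h2 := (ZMod.intCast_zmod_eq_zero_iff_dvd _ N).2 hNd
    rw [Int.cast_sub, Int.cast_one] at h2
    simp only [eq_intCast] at h1
    rw [sub_eq_zero.1 h2] at h1
    exact h1.symm
  obtain ⟨M, hM, hMB⟩ := SL_lift (ZMod.ringHom_surjective _) n _ hdetN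
  refine ⟨M, hM, fun p hp i j => ?_⟩
  haveI : Fact p.Prime := ⟨hS p hp⟩
  have h1 : (N : ℤ) ∣ M i j - B i j := by
    rw [← ZMod.intCast_zmod_eq_zero_iff_dvd]
    push_cast
    rw [sub_eq_zero]
    exact congrFun (congrFun hMB i) j
  have h2 : ((p ^ k : ℕ) : ℤ) ∣ M i j - B i j :=
    (Int.natCast_dvd_natCast.2 (Finset.dvd_prod_of_mem (fun p => p ^ k) hp)).trans h1
  rw [← ZMod.intCast_zmod_eq_zero_iff_dvd] at h2
  push_cast at h2
  have h3 : ((M i j : ℤ) : ℤ_[p]) - A p hp i j ∈ RingHom.ker (PadicInt.toZModPow (p := p) k) := by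
    rw [RingHom.mem_ker, map_sub, ← hb i j p hp, map_intCast]
    simpa [B] using h2
  rw [PadicInt.ker_toZModPow, ← PadicInt.norm_le_pow_iff_mem_span_pow] at h3
  refine lt_of_le_of_lt h3 (lt_of_le_of_lt ?_ hk)
  rw [zpow_neg, zpow_natCast, one_div, inv_pow]
  have : (2 : ℝ) ≤ p := by exact_mod_cast (hS p hp).two_le
  gcongr
end

section
/- Let n ≥ 1, let S be a finite set of primes, and let δ ∈ ℤ. Suppose for each p ∈ S we are given an integer n×n matrix A_p with det(A_p) = δ. Then for every ε > 0 there exists an integer n×n matrix A with det(A) = δ such that for every p ∈ S and all indices i, j one has ‖A_{ij} − (A_p)_{ij}‖_p < ε, where the p-adic norm ‖·‖_p of the integer A_{ij} − (A_p)_{ij} is taken in ℤ_p. -/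
lemma det_congr_aux {n : ℕ} (m : ℤ) (A B : Matrix (Fin n) (Fin n) ℤ)
    (h : ∀ i j, m ∣ A i j - B i j) : m ∣ A.det - B.det := by
  rw [← Ideal.mem_span_singleton, ← Ideal.Quotient.eq, RingHom.map_det, RingHom.map_det]
  congr 1
  ext i j
  simp only [RingHom.mapMatrix_apply, Matrix.map_apply]
  rw [Ideal.Quotient.eq, Ideal.mem_span_singleton]
  exact h i j

lemma diag_aux {n : ℕ} (d : Fin (n + 1) → ℤ) (N s : ℤ) :
    ∃ E : Matrix (Fin (n + 1)) (Fin (n + 1)) ℤ, (∀ i j, N ∣ E i j) ∧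
      (Matrix.diagonal d + E).det = ∏ i, d i + N ^ (n + 1) * s := by
  set T : Matrix (Fin (n + 1)) (Fin (n + 1)) ℤ := Matrix.of fun i j =>
    if i = j then d i else if (j : ℕ) = i + 1 then N else 0 with hT
  have hTdet : T.det = ∏ i, d i := by
    rw [Matrix.det_of_upperTriangular]
    · simp [hT]
    · intro i j hij
      simp only [id] at hij
      have h1 : (j : ℕ) < i := hij
      simp only [hT, Matrix.of_apply]
      rw [if_neg, if_neg]
      · omega
      · rintro rfl; omega
  have hadj : T.adjugate 0 (Fin.last n) = (-1) ^ n * N ^ n := by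
    rw [Matrix.adjugate_fin_succ_eq_det_submatrix, Matrix.det_of_lowerTriangular]
    · simp [hT, Fin.ext_iff]
    · intro i j hij
      have h1 : (i : ℕ) < j := hij
      simp only [hT, Matrix.of_apply, Matrix.submatrix_apply, Fin.succAbove_last,
        Fin.succAbove_zero, Fin.ext_iff, Fin.val_castSucc, Fin.val_succ]
      rw [if_neg, if_neg] <;> omega
  set c : ℤ := (-1) ^ n * N * s with hc
  set B := T.updateRow (Fin.last n) (T (Fin.last n) + c • Pi.single 0 1) with hB
  have hBdet : B.det = ∏ i, d i + N ^ (n + 1) * s := by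
    rw [hB, Matrix.det_updateRow_add, Matrix.det_updateRow_smul, Matrix.updateRow_eq_self,
      ← Matrix.adjugate_apply, hadj, hTdet, hc]
    have : ((-1 : ℤ) ^ n) * (-1) ^ n = 1 := by rw [← mul_pow]; simp
    linear_combination (N ^ (n + 1) * s) * this
  refine ⟨B - Matrix.diagonal d, ?_, by rw [add_sub_cancel]; exact hBdet⟩
  have h1 : ∀ i j, N ∣ T i j - Matrix.diagonal d i j := by
    intro i j
    simp only [hT, Matrix.of_apply, Matrix.diagonal_apply]
    split_ifs <;> simp
  intro i j
  rw [Matrix.sub_apply, hB, Matrix.updateRow_apply]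
  split_ifs with h
  · subst h
    rw [Pi.add_apply, add_sub_right_comm]
    refine dvd_add (h1 _ _) ?_
    rw [Pi.smul_apply, smul_eq_mul, hc]
    exact Dvd.intro_left _ (by ring : ((-1) ^ n * s * (Pi.single 0 1 : Fin (n+1) → ℤ) j) * N = _)
  · exact h1 i j

lemma snf_aux {n : ℕ} (A : Matrix (Fin n) (Fin n) ℤ) (hA : A.det ≠ 0) :
    ∃ (P Q : Matrix (Fin n) (Fin n) ℤ) (d : Fin n → ℤ), IsUnit P.det ∧ IsUnit Q.det ∧
      A = P * Matrix.diagonal d * Q := by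
  set f := Matrix.toLin' A with hf
  have hinj : Function.Injective f := by
    rw [← LinearMap.ker_eq_bot, LinearMap.ker_eq_bot']
    intro v hv
    by_contra hne
    exact hA (Matrix.exists_mulVec_eq_zero_iff.mp ⟨v, hne, by simpa [hf] using hv⟩)
  obtain ⟨b', a, ab', hab⟩ := Submodule.exists_smith_normal_form_of_rank_eq
    (Pi.basisFun ℤ (Fin n)) (LinearMap.finrank_range_of_inj hinj)
  let e := LinearEquiv.ofInjective f hinj
  let c := ab'.map e.symm
  have hc : ∀ i, f (c i) = a i • b' i := by
    intro i
    rw [← hab i]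
    have : e (c i) = ab' i := by simp [c]
    rw [← this]
    rfl
  have hD : LinearMap.toMatrix c b' f = Matrix.diagonal a := by
    ext i j
    rw [LinearMap.toMatrix_apply, hc, Matrix.diagonal_apply]
    simp only [map_smul, Module.Basis.repr_self, Finsupp.smul_apply, smul_eq_mul,
      Finsupp.single_apply]
    by_cases h : i = j
    · subst h; simp
    · simp [h, Ne.symm h]
  have key := basis_toMatrix_mul_linearMap_toMatrix_mul_basis_toMatrix
    (Pi.basisFun ℤ (Fin n)) c (Pi.basisFun ℤ (Fin n)) b' f
  refine ⟨(Pi.basisFun ℤ (Fin n)).toMatrix b', c.toMatrix (Pi.basisFun ℤ (Fin n)), a, ?_, ?_, ?_⟩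
  · rw [← Module.Basis.det_apply]; exact Module.Basis.isUnit_det _ _
  · rw [← Module.Basis.det_apply]; exact Module.Basis.isUnit_det _ _
  · rw [← hD, key]
    rw [hf, ← Matrix.toLin_eq_toLin', LinearMap.toMatrix_toLin]

lemma nonsing_aux {n : ℕ} (A : Matrix (Fin n) (Fin n) ℤ) (M : ℤ) (hM : M ≠ 0) :
    ∃ B : Matrix (Fin n) (Fin n) ℤ, B.det ≠ 0 ∧ ∀ i j, M ∣ B i j - A i j := by
  have : ∃ t : ℤ, (-A).charpoly.eval (M * t) ≠ 0 := by
    by_contra! h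
    apply (-A).charpoly_monic.ne_zero
    apply Polynomial.eq_zero_of_infinite_isRoot
    apply (Set.infinite_range_of_injective (mul_right_injective₀ hM)).mono
    rintro _ ⟨t, rfl⟩
    exact h t
  obtain ⟨t, ht⟩ := this
  rw [Matrix.eval_charpoly] at ht
  refine ⟨_, ht, fun i j => ?_⟩
  rw [sub_neg_eq_add, Matrix.add_apply, add_sub_cancel_right, Matrix.scalar_apply,
    Matrix.diagonal_apply]
  split_ifs <;> simp

lemma lift_aux {n : ℕ} (A : Matrix (Fin (n + 1)) (Fin (n + 1)) ℤ) (N δ : ℤ) (hN : N ≠ 0)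
    (h : N ^ (n + 1) ∣ A.det - δ) :
    ∃ B : Matrix (Fin (n + 1)) (Fin (n + 1)) ℤ, B.det = δ ∧ ∀ i j, N ∣ B i j - A i j := by
  obtain ⟨A', hA', hAA'⟩ := nonsing_aux A (N ^ (n + 1)) (pow_ne_zero _ hN)
  have h' : N ^ (n + 1) ∣ A'.det - δ := by
    have := dvd_add (det_congr_aux _ _ _ hAA') h
    simpa using this
  obtain ⟨s, hs⟩ := h'
  obtain ⟨P, Q, d, hP, hQ, hPQ⟩ := snf_aux A' hA'
  have he : (P.det * Q.det) * (P.det * Q.det) = 1 := by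
    rcases Int.isUnit_iff.mp (hP.mul hQ) with h | h <;> rw [h] <;> rfl
  obtain ⟨E, hE, hEdet⟩ := diag_aux d N (-(P.det * Q.det * s))
  have hdet : A'.det = P.det * (∏ i, d i) * Q.det := by
    rw [hPQ, Matrix.det_mul, Matrix.det_mul, Matrix.det_diagonal]
  refine ⟨P * (Matrix.diagonal d + E) * Q, ?_, ?_⟩
  · rw [Matrix.det_mul, Matrix.det_mul, hEdet]
    linear_combination hs - hdet - N ^ (n + 1) * s * he
  · intro i j
    have h1 : P * (Matrix.diagonal d + E) * Q = A' + P * E * Q := by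
      rw [hPQ, Matrix.mul_add, Matrix.add_mul]
    rw [h1, Matrix.add_apply, add_sub_right_comm]
    refine dvd_add ((dvd_pow_self N (Nat.succ_ne_zero n)).trans (hAA' i j)) ?_
    rw [Matrix.mul_apply]
    refine Finset.dvd_sum fun k _ => Dvd.dvd.mul_right ?_ _
    rw [Matrix.mul_apply]
    exact Finset.dvd_sum fun l _ => Dvd.dvd.mul_left (hE _ _) _

/-- Let `n ≥ 1`, `S` a finite set of primes, `δ ∈ ℤ`. Given for each
`p ∈ S` an integer `n×n` matrix `A p` with determinant `δ`, for every `ε > 0` there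
exists an integer `n×n` matrix `B` with determinant `δ` whose entries are `p`-adically
within `ε` of those of `A p`, for every `p ∈ S`. -/
theorem stmt_11 (n : ℕ) (hn : 1 ≤ n) (S : Finset ℕ) (hS : ∀ p ∈ S, p.Prime) (δ : ℤ)
    (A : ∀ p ∈ S, Matrix (Fin n) (Fin n) ℤ)
    (hA : ∀ p hp, (A p hp).det = δ)
    (ε : ℝ) (hε : 0 < ε) :
    ∃ B : Matrix (Fin n) (Fin n) ℤ, B.det = δ ∧
      ∀ p, ∀ hp : p ∈ S,
        haveI : Fact p.Prime := ⟨hS p hp⟩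
        ∀ i j, ‖((B i j - A p hp i j : ℤ) : ℤ_[p])‖ < ε := by
  obtain ⟨m, rfl⟩ : ∃ m, n = m + 1 := ⟨n - 1, by omega⟩
  obtain ⟨k, hk⟩ := exists_pow_lt_of_lt_one hε (by norm_num : (1 / 2 : ℝ) < 1)
  have hcrt : ∀ i j, ∃ y : ℤ, ∀ p, ∀ hp : p ∈ S,
      ((p : ℤ) ^ k) ^ (m + 1) ∣ y - A p hp i j := by
    intro i j
    obtain ⟨y, hy⟩ := IsDedekindDomain.exists_forall_sub_mem_ideal (R := ℤ) (s := S)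
      (fun p : ℕ => Ideal.span {(p : ℤ)}) (fun _ => k * (m + 1))
      (fun p hp => by
        have := Nat.prime_iff_prime_int.mp (hS p hp)
        exact (Ideal.prime_iff_isPrime (by simpa using this.ne_zero)).mpr
          ((Ideal.span_singleton_prime this.ne_zero).mpr this))
      (fun p hp q hq hpq h => by
        rw [Ideal.span_singleton_eq_span_singleton, Int.associated_iff_natAbs] at h
        exact hpq (by simpa using h))
      (fun p => A p.1 p.2 i j)
    refine ⟨y, fun p hp => ?_⟩
    have := hy p hp
    rwa [Ideal.span_singleton_pow, Ideal.mem_span_singleton, pow_mul] at this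
  choose C hC using hcrt
  have hdvd : (∏ p ∈ S, (p : ℤ) ^ k) ^ (m + 1) ∣ (Matrix.of C).det - δ := by
    rw [← Finset.prod_pow]
    refine Finset.prod_dvd_of_coprime ?_ ?_
    · intro p hp q hq hpq
      have : IsCoprime (p : ℤ) (q : ℤ) :=
        Nat.isCoprime_iff_coprime.mpr ((Nat.coprime_primes (hS p hp) (hS q hq)).mpr hpq)
      exact (this.pow).pow
    · intro p hp
      rw [← hA p hp]
      exact det_congr_aux _ _ _ fun i j => hC i j p hp
  obtain ⟨B, hB, hBC⟩ := lift_aux (Matrix.of C) _ δ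
    (Finset.prod_ne_zero_iff.mpr fun p hp =>
      pow_ne_zero _ (by exact_mod_cast (hS p hp).ne_zero)) hdvd
  refine ⟨B, hB, fun p hp => ?_⟩
  haveI : Fact p.Prime := ⟨hS p hp⟩
  intro i j
  have h1 : (p : ℤ) ^ k ∣ B i j - A p hp i j := by
    have h2 := (Finset.dvd_prod_of_mem (fun p : ℕ => (p : ℤ) ^ k) hp).trans (hBC i j)
    have h3 := (dvd_pow_self ((p : ℤ) ^ k) (Nat.succ_ne_zero m)).trans (hC i j p hp)
    have := dvd_add h2 h3
    simpa using this
  refine lt_of_le_of_lt (PadicInt.norm_int_le_pow_iff_dvd.mpr h1) (lt_of_le_of_lt ?_ hk)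
  rw [zpow_neg, zpow_natCast, one_div, inv_pow]
  have h2 : (2 : ℝ) ≤ p := by exact_mod_cast (hS p hp).two_le
  gcongr
end

section
/- Let n ≥ 1 be an integer and τ ∈ ℂ with Im τ > 0, and set q := exp(2πiτ). Define f : ℂ → ℂ by f(z) = exp(2πiτ·n/8) · ∏_{m=1}^∞ (1 − q^{nm} e^{2πinz}) · ∏_{m=0}^∞ (1 − q^{nm} e^{−2πinz}) · ∏_{m=1}^∞ (1 − q^{nm}). Then f(0) = 0 and f is complex differentiable at 0 with derivative f′(0) = 2πin · exp(2πiτ·n/8) · ∏_{m=1}^∞ (1 − q^{nm})³. -/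
open Complex

/-- With `q = exp(2πiτ)`,
`f(z) = exp(2πiτ·n/8) ∏_{m≥1}(1−q^{nm}e^{2πinz}) ∏_{m≥0}(1−q^{nm}e^{−2πinz}) ∏_{m≥1}(1−q^{nm})`. -/
noncomputable def ffun (n : ℕ) (τ : ℂ) (z : ℂ) : ℂ :=
  Complex.exp (2 * (Real.pi : ℂ) * Complex.I * τ * (n : ℂ) / 8) *
    (∏' m : ℕ, (1 - Complex.exp (2 * (Real.pi : ℂ) * Complex.I * τ) ^ (n * (m + 1)) *
      Complex.exp (2 * (Real.pi : ℂ) * Complex.I * (n : ℂ) * z))) *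
    (∏' m : ℕ, (1 - Complex.exp (2 * (Real.pi : ℂ) * Complex.I * τ) ^ (n * m) *
      Complex.exp (-(2 * (Real.pi : ℂ) * Complex.I * (n : ℂ) * z)))) *
    (∏' m : ℕ, (1 - Complex.exp (2 * (Real.pi : ℂ) * Complex.I * τ) ^ (n * (m + 1))))

theorem aux_mult (r : ℂ) (hr : ‖r‖ < 1) (w : ℂ) :
    Multipliable (fun m : ℕ => 1 - r ^ (m + 1) * w) := by
  have h1 : Summable (fun m : ℕ => ‖-(r ^ (m + 1) * w)‖) := by
    have := ((summable_geometric_of_lt_one (norm_nonneg r) hr).mul_right (‖r‖ * ‖w‖))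
    refine this.congr fun m => ?_
    simp only [norm_neg, norm_mul, norm_pow]
    ring
  simpa only [sub_eq_add_neg] using multipliable_one_add_of_summable h1

theorem aux_diff (r : ℂ) (hr : ‖r‖ < 1) :
    DifferentiableAt ℂ (fun w : ℂ => ∏' m : ℕ, (1 - r ^ (m + 1) * w)) 1 := by
  have hu : Summable (fun m : ℕ => ‖r‖ ^ m * (‖r‖ * 2)) :=
    (summable_geometric_of_lt_one (norm_nonneg r) hr).mul_right _
  have h := Summable.hasProdLocallyUniformlyOn_nat_one_add
    (f := fun (m : ℕ) (w : ℂ) => -(r ^ (m + 1) * w)) (K := Metric.ball (0 : ℂ) 2)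
    Metric.isOpen_ball hu
    (Filter.Eventually.of_forall fun m w hw => by
      have hw' : ‖w‖ ≤ 2 := by simpa using (Metric.mem_ball.1 hw).le
      simp only [norm_neg, norm_mul, norm_pow, pow_succ, mul_assoc]
      gcongr)
    (fun m => by fun_prop)
  rw [hasProdLocallyUniformlyOn_iff_tendstoLocallyUniformlyOn] at h
  have hd := h.differentiableOn (Filter.Eventually.of_forall fun s => by fun_prop)
    Metric.isOpen_ball
  simp only [← sub_eq_add_neg] at hd
  exact hd.differentiableAt (Metric.isOpen_ball.mem_nhds (by simp))

/-- Let `n ≥ 1` and `Im τ > 0`, `q = exp(2πiτ)`. Then `f(0) = 0` and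
`f` is complex differentiable at `0` with `f′(0) = 2πin·exp(2πiτ·n/8)·∏_{m≥1}(1−q^{nm})³`. -/
theorem stmt_14 (n : ℕ) (hn : 1 ≤ n) (τ : ℂ) (hτ : 0 < τ.im) :
    ffun n τ 0 = 0 ∧
    HasDerivAt (ffun n τ)
      (2 * (Real.pi : ℂ) * Complex.I * (n : ℂ) *
        Complex.exp (2 * (Real.pi : ℂ) * Complex.I * τ * (n : ℂ) / 8) *
        ∏' m : ℕ, (1 - Complex.exp (2 * (Real.pi : ℂ) * Complex.I * τ) ^ (n * (m + 1))) ^ 3)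
      0 := by
  have hq : ‖Complex.exp (2 * (Real.pi : ℂ) * Complex.I * τ)‖ < 1 :=
    UpperHalfPlane.norm_exp_two_pi_I_lt_one ⟨τ, hτ⟩
  have hr : ‖Complex.exp (2 * (Real.pi : ℂ) * Complex.I * τ) ^ n‖ < 1 := by
    rw [norm_pow]
    exact pow_lt_one₀ (norm_nonneg _) hq (by omega)
  have hf : ffun n τ = fun z =>
      (1 - Complex.exp (-(2 * (Real.pi : ℂ) * Complex.I * (n : ℂ) * z))) *
      (Complex.exp (2 * (Real.pi : ℂ) * Complex.I * τ * (n : ℂ) / 8) *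
      (∏' m : ℕ, (1 - (Complex.exp (2 * (Real.pi : ℂ) * Complex.I * τ) ^ n) ^ (m + 1) *
        Complex.exp (2 * (Real.pi : ℂ) * Complex.I * (n : ℂ) * z))) *
      (∏' m : ℕ, (1 - (Complex.exp (2 * (Real.pi : ℂ) * Complex.I * τ) ^ n) ^ (m + 1) *
        Complex.exp (-(2 * (Real.pi : ℂ) * Complex.I * (n : ℂ) * z)))) *
      (∏' m : ℕ, (1 - (Complex.exp (2 * (Real.pi : ℂ) * Complex.I * τ) ^ n) ^ (m + 1) * 1))) := by
    funext z
    unfold ffun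
    simp only [pow_mul, mul_one]
    rw [tprod_eq_zero_mul' (f := fun m : ℕ =>
      1 - (Complex.exp (2 * (Real.pi : ℂ) * Complex.I * τ) ^ n) ^ m *
      Complex.exp (-(2 * (Real.pi : ℂ) * Complex.I * (n : ℂ) * z))) (aux_mult _ hr _)]
    rw [pow_zero, one_mul]
    ring
  have hm := aux_mult _ hr 1
  have hD := aux_diff _ hr
  simp only [pow_mul]
  rw [hf]
  generalize Complex.exp (2 * (Real.pi : ℂ) * Complex.I * τ) ^ n = r at *
  generalize Complex.exp (2 * (Real.pi : ℂ) * Complex.I * τ * (n : ℂ) / 8) = C at *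
  generalize 2 * (Real.pi : ℂ) * Complex.I * (n : ℂ) = a at *
  have e3 : ∏' m : ℕ, (1 - r ^ (m + 1)) ^ 3 = (∏' m : ℕ, (1 - r ^ (m + 1) * 1)) ^ 3 := by
    rw [← hm.tprod_pow]
    simp only [mul_one]
  rw [e3]
  refine ⟨by simp, ?_⟩
  set P : ℂ → ℂ := fun w => ∏' m : ℕ, (1 - r ^ (m + 1) * w) with hP
  change HasDerivAt (fun z => (1 - Complex.exp (-(a * z))) *
    (C * P (Complex.exp (a * z)) * P (Complex.exp (-(a * z))) * P 1)) (a * C * P 1 ^ 3) 0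
  clear_value P
  have d0 : HasDerivAt (fun z => 1 - Complex.exp (-(a * z))) a 0 := by
    have := ((((hasDerivAt_id (0 : ℂ)).const_mul a).neg).cexp).const_sub 1
    simpa using this
  have d1 : DifferentiableAt ℂ (fun z => P (Complex.exp (a * z))) 0 :=
    DifferentiableAt.comp (g := P) (0 : ℂ) (by simpa using hD) (by fun_prop)
  have d2 : DifferentiableAt ℂ (fun z => P (Complex.exp (-(a * z)))) 0 :=
    DifferentiableAt.comp (g := P) (0 : ℂ) (by simpa using hD) (by fun_prop)
  have d3 := d0.mul (((d1.const_mul C).mul d2).mul_const (P 1)).hasDerivAt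
  refine HasDerivAt.congr_deriv d3 ?_
  simp only [Pi.mul_apply, mul_zero, neg_zero, Complex.exp_zero, sub_self, zero_mul, add_zero]
  ring
end

section
/- Let n ≥ 2 be an integer, ζ ∈ ℂ a primitive n-th root of unity, a₁, …, a_{n−1} nonzero complex numbers, and k an integer with 1 ≤ k ≤ n−1. For 1 ≤ j ≤ n−1 define the linear form x′_j := ∑_{i=1}^{n−1} a_j ζ^{ij} x_i in the polynomial ring ℂ[x₁,…,x_{n−1}]. For an integer t not divisible by n, write ⟨t⟩ for the unique representative of t mod n in {1,…,n−1}. Then the following identity holds in ℂ[x₁,…,x_{n−1}]: ∑_{i=1, i≠k}^{n−1} (a_k / (a_i · a_{⟨k−i⟩})) · x′_i · x′_{⟨k−i⟩} = ∑_{p=1}^{n−1} a_k ζ^{pk} ( n·x_p² − 2·x_p·∑_{s=1}^{n−1} x_s ). -/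
open MvPolynomial

lemma aux_orth (n : ℕ) (hn : 2 ≤ n) (ζ : ℂ) (hζ : IsPrimitiveRoot ζ n) (k : ℕ) (p q : ℕ)
    (hp : p < n) (hq : q < n) :
    ∑ i ∈ Finset.range n, ζ ^ ((p : ℤ) * (i : ℤ)) * ζ ^ ((q : ℤ) * ((k : ℤ) - (i : ℤ)))
      = if p = q then (n : ℂ) * ζ ^ (p * k) else 0 := by
  have h0 : ζ ≠ 0 := hζ.ne_zero (by omega)
  have h1 : ∀ i ∈ Finset.range n,
      ζ ^ ((p : ℤ) * (i : ℤ)) * ζ ^ ((q : ℤ) * ((k : ℤ) - (i : ℤ)))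
        = ζ ^ (q * k) * (ζ ^ ((p : ℤ) - q)) ^ i := by
    intro i _
    rw [← zpow_natCast, ← zpow_natCast, ← zpow_mul, ← zpow_add₀ h0, ← zpow_add₀ h0]
    congr 1
    push_cast
    ring
  rw [Finset.sum_congr rfl h1, ← Finset.mul_sum]
  split_ifs with h
  · subst h
    simp [mul_comm]
  · have hne : ζ ^ ((p : ℤ) - q) ≠ 1 := by
      intro h2
      rw [zpow_sub₀ h0, div_eq_one_iff_eq (zpow_ne_zero _ h0)] at h2
      exact h (hζ.pow_inj hp hq (by exact_mod_cast h2))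
    have hpow : (ζ ^ ((p : ℤ) - q)) ^ n = 1 := by
      rw [← zpow_natCast, ← zpow_mul, mul_comm, zpow_mul, zpow_natCast, hζ.pow_eq_one, one_zpow]
    rw [geom_sum_eq hne, hpow]
    simp

noncomputable def auxY (n : ℕ) (ζ : ℂ) (j : ℤ) : MvPolynomial ℕ ℂ :=
  ∑ p ∈ Finset.Icc 1 (n - 1), C (ζ ^ ((p : ℤ) * j)) * X p

lemma aux_full (n : ℕ) (hn : 2 ≤ n) (ζ : ℂ) (hζ : IsPrimitiveRoot ζ n) (k : ℕ) :
    ∑ i ∈ Finset.range n, auxY n ζ i * auxY n ζ ((k : ℤ) - i)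
      = ∑ p ∈ Finset.Icc 1 (n - 1), C ((n : ℂ) * ζ ^ (p * k)) * X p ^ 2 := by
  simp only [auxY, Finset.sum_mul_sum]
  rw [Finset.sum_comm]
  apply Finset.sum_congr rfl
  intro p hp
  rw [Finset.sum_comm]
  rw [Finset.mem_Icc] at hp
  rw [Finset.sum_eq_single p]
  · have := aux_orth n hn ζ hζ k p p (by omega) (by omega)
    rw [if_pos rfl] at this
    rw [← this, map_sum, Finset.sum_mul]
    refine Finset.sum_congr rfl fun i _ => ?_
    rw [C_mul]; ring
  · intro q hq hqp
    rw [Finset.mem_Icc] at hq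
    have := aux_orth n hn ζ hζ k p q (by omega) (by omega)
    rw [if_neg (Ne.symm hqp)] at this
    have h2 := congrArg (fun z => C z * (X p * X q : MvPolynomial ℕ ℂ)) this
    simp only [map_sum, Finset.sum_mul, C_0, zero_mul] at h2
    rw [← h2]
    refine Finset.sum_congr rfl fun i _ => ?_
    rw [C_mul]; ring
  · intro h
    exact absurd (Finset.mem_Icc.2 hp) h


/-- Let `n ≥ 2`, `ζ` a primitive `n`-th root of unity,
`a₁,…,a_{n−1}` nonzero complex numbers, and `1 ≤ k ≤ n−1`. With
`x′_j = ∑_{i=1}^{n−1} a_j ζ^{ij} x_i` and `⟨t⟩ ∈ {1,…,n−1}` the representative of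
`t mod n` (for `n ∤ t`), we have
`∑_{i≠k} (a_k/(a_i a_{⟨k−i⟩})) x′_i x′_{⟨k−i⟩}
  = ∑_p a_k ζ^{pk} (n x_p² − 2 x_p ∑_s x_s)` in `ℂ[x₁,…,x_{n−1}]`. -/
theorem stmt_17 (n : ℕ) (hn : 2 ≤ n) (ζ : ℂ) (hζ : IsPrimitiveRoot ζ n)
    (a : ℕ → ℂ) (ha : ∀ i, 1 ≤ i → i ≤ n - 1 → a i ≠ 0)
    (k : ℕ) (hk1 : 1 ≤ k) (hk2 : k ≤ n - 1) :
    let rep : ℤ → ℕ := fun t => ((t : ZMod n)).val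
    let x' : ℕ → MvPolynomial ℕ ℂ := fun j =>
      ∑ i ∈ Finset.Icc 1 (n - 1), C (a j * ζ ^ (i * j)) * X i
    (∑ i ∈ (Finset.Icc 1 (n - 1)).erase k,
        C (a k / (a i * a (rep ((k : ℤ) - (i : ℤ))))) *
          (x' i * x' (rep ((k : ℤ) - (i : ℤ)))))
      = ∑ p ∈ Finset.Icc 1 (n - 1),
          C (a k * ζ ^ (p * k)) *
            ((n : MvPolynomial ℕ ℂ) * X p ^ 2 -
              2 * X p * ∑ s ∈ Finset.Icc 1 (n - 1), X s) := by
  intro rep x'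
  have h0 : ζ ≠ 0 := hζ.ne_zero (by omega)
  haveI : NeZero n := ⟨by omega⟩
  have hrep : ∀ t : ℤ, ((rep t : ℕ) : ℤ) = t % n := fun t => ZMod.val_intCast t
  have hx : ∀ j : ℕ, ∀ t : ℤ, (j : ℤ) = t % n → x' j = C (a j) * auxY n ζ t := by
    intro j t hj
    simp only [x', auxY, Finset.mul_sum]
    refine Finset.sum_congr rfl fun p _ => ?_
    have : ζ ^ (p * j) = ζ ^ ((p : ℤ) * t) := by
      rw [← zpow_natCast]
      push_cast
      rw [hj]
      conv_rhs => rw [← Int.emod_add_mul_ediv t n, mul_add, zpow_add₀ h0, mul_left_comm,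
        zpow_mul ζ (n : ℤ), zpow_natCast ζ n, hζ.pow_eq_one, one_zpow, mul_one]
    rw [this, C_mul, mul_assoc]
  have hterm : ∀ i ∈ (Finset.Icc 1 (n - 1)).erase k,
      C (a k / (a i * a (rep ((k : ℤ) - (i : ℤ))))) *
          (x' i * x' (rep ((k : ℤ) - (i : ℤ))))
        = C (a k) * (auxY n ζ i * auxY n ζ ((k : ℤ) - i)) := by
    intro i hi
    rw [Finset.mem_erase, Finset.mem_Icc] at hi
    obtain ⟨hik, hi1, hi2⟩ := hi
    have hr := hrep ((k : ℤ) - i)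
    have hlt : rep ((k : ℤ) - i) < n := ZMod.val_lt _
    have hpos : rep ((k : ℤ) - i) ≠ 0 := by
      intro hz
      rw [hz] at hr
      have hd : (n : ℤ) ∣ (k : ℤ) - i := Int.dvd_of_emod_eq_zero (by simpa using hr.symm)
      have := Int.eq_zero_of_abs_lt_dvd hd (by rw [abs_lt]; constructor <;> omega)
      omega
    rw [hx i i (by rw [Int.emod_eq_of_lt] <;> omega), hx _ _ hr]
    have e1 := ha i hi1 hi2
    have e2 := ha (rep ((k : ℤ) - i)) (by omega) (by omega)
    generalize a (rep ((k : ℤ) - i)) = b at *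
    have : C (a k) = (C (a k / (a i * b)) * C (a i) * C b : MvPolynomial ℕ ℂ) := by
      rw [← C_mul, ← C_mul]
      congr 1
      field_simp
    rw [this]
    ring
  rw [Finset.sum_congr rfl hterm, ← Finset.mul_sum]
  have hfull := aux_full n hn ζ hζ k
  have hr : Finset.range n = insert 0 (Finset.Icc 1 (n - 1)) := by
    ext i
    simp only [Finset.mem_range, Finset.mem_insert, Finset.mem_Icc]
    omega
  rw [hr, Finset.sum_insert (by simp),
    ← Finset.add_sum_erase _ _ (Finset.mem_Icc.2 ⟨hk1, hk2⟩)] at hfull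
  have hY0 : auxY n ζ 0 = ∑ s ∈ Finset.Icc 1 (n - 1), X s := by simp [auxY]
  have hYk : auxY n ζ k = ∑ p ∈ Finset.Icc 1 (n - 1), C (ζ ^ (p * k)) * X p := by
    simp only [auxY]
    refine Finset.sum_congr rfl fun p _ => ?_
    rw [← zpow_natCast]
    push_cast
    rfl
  simp only [Nat.cast_zero, sub_zero, sub_self] at hfull
  have hE : ∑ i ∈ (Finset.Icc 1 (n - 1)).erase k, auxY n ζ i * auxY n ζ ((k : ℤ) - i)
      = ∑ p ∈ Finset.Icc 1 (n - 1), C ((n : ℂ) * ζ ^ (p * k)) * X p ^ 2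
        - auxY n ζ k * (2 * auxY n ζ 0) := by
    rw [← hfull]; ring
  rw [hE, hYk, hY0, Finset.sum_mul, ← Finset.sum_sub_distrib, Finset.mul_sum]
  refine Finset.sum_congr rfl fun p _ => ?_
  rw [C_mul, C_mul, map_natCast]
  ring
end
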